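/- arXiv:2508.19413 — 5 statements merged into one kernel-verified Lean document; each statement's English description precedes it below -/
import Mathlib

section
/- For every n ≥ 3 there exist pairwise disjoint convex sets K₁, …, Kₙ ⊆ ℝ² such that the set S = ℝ² \ (K₁ ∪ … ∪ Kₙ) is finite and |S| = 5n − 11. -/
open Metric Set

/-- A family of pairwise disjoint convex sets whose union misses exactly `m` points. -/
structure IsConvexPacking {E ι : Type*} [AddCommGroup E] [Module ℝ E]
    (K : ι → Set E) (m : ℕ) : Prop where
  convex : ∀ i, Convex ℝ (K i)
  disjoint : Pairwise fun i j => Disjoint (K i) (K j)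
  finite : (⋃ i, K i)ᶜ.Finite
  ncard : (⋃ i, K i)ᶜ.ncard = m

theorem IsConvexPacking.preimage {E F ι : Type*} [AddCommGroup E] [Module ℝ E]
    [AddCommGroup F] [Module ℝ F] {K : ι → Set F} {m : ℕ} (h : IsConvexPacking K m) (e : E ≃ F)
    (he : ∀ x y : E, ∀ a b : ℝ, a + b = 1 → e (a • x + b • y) = a • e x + b • e y) :
    IsConvexPacking (fun i => e ⁻¹' K i) m := by
  have hc : (⋃ i, e ⁻¹' K i)ᶜ = e ⁻¹' (⋃ i, K i)ᶜ := by
    rw [← preimage_iUnion, preimage_compl]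
  refine ⟨fun i x hx y hy a b ha hb hab => ?_, fun i j hij => (h.disjoint hij).preimage e, ?_, ?_⟩
  · rw [mem_preimage, he x y a b hab]
    exact h.convex i hx hy ha hb hab
  · rw [hc]
    exact h.finite.preimage e.injective.injOn
  · rw [hc, ncard_preimage_of_injective_subset_range e.injective (by simp), h.ncard]

/-- An open half-plane together with an open half-line of its boundary. -/
def lexHalfPlane (a b c a' b' c' : ℝ) : Set (ℝ × ℝ) :=
  {x | c < a * x.1 + b * x.2 ∨ (a * x.1 + b * x.2 = c ∧ c' < a' * x.1 + b' * x.2)}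

theorem convex_lexHalfPlane (a b c a' b' c' : ℝ) : Convex ℝ (lexHalfPlane a b c a' b' c') := by
  intro x hx y hy s t hs ht hst
  rcases hs.eq_or_lt with rfl | hs
  · obtain rfl : t = 1 := by linarith
    simpa using hy
  rcases ht.eq_or_lt with rfl | ht
  · obtain rfl : s = 1 := by linarith
    simpa using hx
  obtain rfl : t = 1 - s := by linarith
  simp only [lexHalfPlane, mem_ofPred_eq, Prod.fst_add, Prod.snd_add, Prod.smul_fst, Prod.smul_snd,
    smul_eq_mul] at hx hy ⊢
  rcases hx with hx | ⟨hx, hx'⟩ <;> rcases hy with hy | ⟨hy, hy'⟩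
  · left; nlinarith [mul_pos hs (sub_pos.2 hx), mul_pos ht (sub_pos.2 hy)]
  · left; subst hy; nlinarith [mul_pos hs (sub_pos.2 hx)]
  · left; subst hx; nlinarith [mul_pos ht (sub_pos.2 hy)]
  · right
    refine ⟨by linear_combination s * hx + (1 - s) * hy, ?_⟩
    nlinarith [mul_pos hs (sub_pos.2 hx'), mul_pos ht (sub_pos.2 hy')]

/-- Near the origin the sets `K i`, `K j`, `K k` are the three sectors cut out by the rays
spanned by `(1, 0)`, `(0, 1)` and `(-1, -1)`, and they miss the origin only. -/
structure IsTripod {ι : Type*} (K : ι → Set (ℝ × ℝ)) (i j k : ι) : Prop where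
  zero_notMem : ∀ l, (0, 0) ∉ K l
  subset_fst : ∀ x ∈ K i, x.1 ≤ 0 ∧ x.1 ≤ x.2
  subset_snd : ∀ x ∈ K j, x.2 ≤ 0 ∧ x.2 ≤ x.1
  subset_trd : ∀ x ∈ K k, 0 ≤ x.1 ∧ 0 ≤ x.2
  cover : ∀ x : ℝ × ℝ, x ≠ (0, 0) → x.1 + x.2 ≤ 2 → x.2 - 2 * x.1 ≤ 2 → x.1 - 2 * x.2 ≤ 2 →
    x ∈ K i ∨ x ∈ K j ∨ x ∈ K k

/-- Three sectors with one puncture on each of the bounding rays. -/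
def puncturedSector : Fin 3 → Set (ℝ × ℝ) :=
  ![lexHalfPlane (-1) 0 0 0 (-1) (-3) ∩ lexHalfPlane (-1) 1 0 (-1) 0 3,
    lexHalfPlane 0 (-1) 0 1 0 3 ∩ lexHalfPlane 1 (-1) 0 1 0 (-3),
    lexHalfPlane 1 0 0 0 1 3 ∩ lexHalfPlane 0 1 0 (-1) 0 (-3)]

theorem compl_iUnion_puncturedSector :
    (⋃ i, puncturedSector i)ᶜ = {((0 : ℝ), (0 : ℝ)), (3, 0), (0, 3), (-3, -3)} := by
  ext ⟨a, b⟩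
  simp only [mem_compl_iff, mem_iUnion, Fin.exists_fin_succ, puncturedSector, lexHalfPlane,
    mem_insert_iff, mem_singleton_iff, Prod.mk.injEq]
  simp
  grind

theorem isConvexPacking_puncturedSector : IsConvexPacking puncturedSector 4 := by
  refine ⟨?_, ?_, ?_, ?_⟩
  · intro i
    fin_cases i <;> exact (convex_lexHalfPlane ..).inter (convex_lexHalfPlane ..)
  · intro i j hij
    rw [Set.disjoint_left]
    rintro ⟨a, b⟩
    fin_cases i <;> fin_cases j <;> simp [puncturedSector, lexHalfPlane] at hij ⊢ <;> grind
  · rw [compl_iUnion_puncturedSector]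
    exact toFinite _
  · rw [compl_iUnion_puncturedSector]
    rw [ncard_insert_of_notMem, ncard_insert_of_notMem, ncard_pair] <;> norm_num

theorem isTripod_puncturedSector : IsTripod puncturedSector 0 1 2 := by
  refine ⟨?_, ?_, ?_, ?_, ?_⟩
  · intro l
    fin_cases l <;> simp [puncturedSector, lexHalfPlane]
  all_goals
    rintro ⟨a, b⟩
    simp [puncturedSector, lexHalfPlane]
    grind

/-- The triangle with vertices `(1, 0)`, `(0, 1)` and `(-1, -1)`, with half of each edge. -/
def centralTriangle : Set (ℝ × ℝ) :=
  lexHalfPlane (-1) (-1) (-1) (-1) 0 (-1 / 2) ∩ lexHalfPlane 2 (-1) (-1) (-1) 0 (1 / 2) ∩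
    lexHalfPlane (-1) 2 (-1) 1 0 0

/-- The vertices and the edge midpoints of the central triangle. -/
def trianglePoints : Set (ℝ × ℝ) :=
  {(1, 0), (0, 1), (-1, -1), (1 / 2, 1 / 2), (-1 / 2, 0), (0, -1 / 2)}

theorem mem_centralTriangle {x : ℝ × ℝ} : x ∈ centralTriangle ↔
    (x.1 + x.2 < 1 ∨ (x.1 + x.2 = 1 ∧ x.1 < 1 / 2)) ∧
    (x.2 - 2 * x.1 < 1 ∨ (x.2 - 2 * x.1 = 1 ∧ x.1 < -1 / 2)) ∧
    (x.1 - 2 * x.2 < 1 ∨ (x.1 - 2 * x.2 = 1 ∧ 0 < x.1)) := by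
  simp only [centralTriangle, lexHalfPlane, mem_inter_iff, mem_ofPred_eq]
  grind

theorem mem_trianglePoints {x : ℝ × ℝ} : x ∈ trianglePoints ↔
    (x.1 = 1 ∧ x.2 = 0) ∨ (x.1 = 0 ∧ x.2 = 1) ∨ (x.1 = -1 ∧ x.2 = -1) ∨
    (x.1 = 1 / 2 ∧ x.2 = 1 / 2) ∨ (x.1 = -1 / 2 ∧ x.2 = 0) ∨ (x.1 = 0 ∧ x.2 = -1 / 2) := by
  simp only [trianglePoints, mem_insert_iff, mem_singleton_iff, Prod.ext_iff]

theorem ncard_trianglePoints : trianglePoints.ncard = 6 := by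
  rw [trianglePoints, ncard_insert_of_notMem, ncard_insert_of_notMem, ncard_insert_of_notMem,
    ncard_insert_of_notMem, ncard_pair] <;> norm_num

/-- Insert the central triangle into a family of sets, removing also its vertices and
edge midpoints. -/
def insertTriangle {n : ℕ} (K : Fin n → Set (ℝ × ℝ)) : Fin (n + 1) → Set (ℝ × ℝ) :=
  Fin.cons centralTriangle fun l => K l \ (centralTriangle ∪ trianglePoints)

theorem IsTripod.convex_diff {ι : Type*} {K : ι → Set (ℝ × ℝ)} {i j k : ι} (h : IsTripod K i j k)
    (hK : ∀ l, Convex ℝ (K l)) (hd : Pairwise fun i j => Disjoint (K i) (K j)) (l : ι) :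
    Convex ℝ (K l \ (centralTriangle ∪ trianglePoints)) := by
  have key : ∀ C : Set (ℝ × ℝ), Convex ℝ C →
      (∀ x ∈ K l, x ∉ centralTriangle ∪ trianglePoints ↔ x ∈ C) →
      Convex ℝ (K l \ (centralTriangle ∪ trianglePoints)) := by
    intro C hC hKC
    have : K l \ (centralTriangle ∪ trianglePoints) = K l ∩ C := by
      ext x
      exact and_congr_right (hKC x)
    rw [this]
    exact (hK l).inter hC
  have h0 : ∀ x ∈ K l, x.1 = 0 → x.2 ≠ 0 := by
    rintro ⟨a, b⟩ hx rfl rfl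
    exact h.zero_notMem l hx
  by_cases hi : l = i
  · refine key (lexHalfPlane (-2) 1 1 1 0 (-1 / 2) ∩ lexHalfPlane (-2) 1 1 (-1) 0 0)
      ((convex_lexHalfPlane ..).inter (convex_lexHalfPlane ..)) fun x hx => ?_
    have h1 := h0 x hx
    have h2 := h.subset_fst x (hi ▸ hx)
    simp only [mem_union, mem_centralTriangle, mem_trianglePoints, lexHalfPlane, mem_inter_iff,
      mem_ofPred_eq]
    grind
  by_cases hj : l = j
  · refine key (lexHalfPlane 1 (-2) 1 (-1) 0 0 ∩ lexHalfPlane 1 (-2) 1 1 0 (-1))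
      ((convex_lexHalfPlane ..).inter (convex_lexHalfPlane ..)) fun x hx => ?_
    have h1 := h0 x hx
    have h2 := h.subset_snd x (hj ▸ hx)
    simp only [mem_union, mem_centralTriangle, mem_trianglePoints, lexHalfPlane, mem_inter_iff,
      mem_ofPred_eq]
    grind
  by_cases hk : l = k
  · refine key (lexHalfPlane 1 1 1 1 0 (1 / 2) ∩ lexHalfPlane 1 1 1 (-1) 0 (-1))
      ((convex_lexHalfPlane ..).inter (convex_lexHalfPlane ..)) fun x hx => ?_
    have h1 := h0 x hx
    have h2 := h.subset_trd x (hk ▸ hx)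
    simp only [mem_union, mem_centralTriangle, mem_trianglePoints, lexHalfPlane, mem_inter_iff,
      mem_ofPred_eq]
    grind
  refine key univ convex_univ fun x hx => iff_of_true (fun hxT => ?_) trivial
  have hx0 : x ≠ (0, 0) := fun hx' => h.zero_notMem l (hx' ▸ hx)
  have hT : x.1 + x.2 ≤ 2 ∧ x.2 - 2 * x.1 ≤ 2 ∧ x.1 - 2 * x.2 ≤ 2 := by
    simp only [mem_union, mem_centralTriangle, mem_trianglePoints] at hxT
    grind
  rcases h.cover x hx0 hT.1 hT.2.1 hT.2.2 with h' | h' | h'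
  · exact (hd hi).notMem_of_mem_left hx h'
  · exact (hd hj).notMem_of_mem_left hx h'
  · exact (hd hk).notMem_of_mem_left hx h'

theorem IsTripod.mem_iUnion {ι : Type*} {K : ι → Set (ℝ × ℝ)} {i j k : ι} (h : IsTripod K i j k)
    {x : ℝ × ℝ} (hx : x ∈ centralTriangle ∪ trianglePoints) (hx0 : x ≠ (0, 0)) :
    x ∈ ⋃ l, K l := by
  have hT : x.1 + x.2 ≤ 2 ∧ x.2 - 2 * x.1 ≤ 2 ∧ x.1 - 2 * x.2 ≤ 2 := by
    simp only [mem_union, mem_centralTriangle, mem_trianglePoints] at hx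
    grind
  rcases h.cover x hx0 hT.1 hT.2.1 hT.2.2 with h' | h' | h' <;> exact mem_iUnion_of_mem _ h'

theorem IsTripod.compl_iUnion_insertTriangle {n : ℕ} {K : Fin n → Set (ℝ × ℝ)} {i j k : Fin n}
    (h : IsTripod K i j k) :
    (⋃ l, insertTriangle K l)ᶜ = ((⋃ l, K l)ᶜ \ {(0, 0)}) ∪ trianglePoints := by
  have hdisj : ∀ x ∈ trianglePoints, x ∉ centralTriangle := by
    intro x hx
    rw [mem_trianglePoints] at hx
    rw [mem_centralTriangle]
    grind
  have h0 : ((0 : ℝ), (0 : ℝ)) ∈ centralTriangle := by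
    rw [mem_centralTriangle]
    norm_num
  ext x
  have hx := h.mem_iUnion (x := x)
  have hd := hdisj x
  have h0x : x = (0, 0) → x ∈ centralTriangle := fun hx => hx ▸ h0
  simp only [mem_compl_iff, Set.mem_iUnion, Fin.exists_fin_succ, insertTriangle, Fin.cons_zero,
    Fin.cons_succ, mem_sdiff, mem_union, mem_singleton_iff, exists_and_right] at hx ⊢
  grind

theorem IsTripod.isConvexPacking_insertTriangle {n m : ℕ} {K : Fin n → Set (ℝ × ℝ)}
    {i j k : Fin n} (h : IsTripod K i j k) (hK : IsConvexPacking K m) :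
    IsConvexPacking (insertTriangle K) (m + 5) := by
  have hfin : trianglePoints.Finite :=
    finite_of_ncard_ne_zero (by simp [ncard_trianglePoints])
  refine ⟨?_, ?_, ?_, ?_⟩
  · intro l
    refine Fin.cases ?_ (fun l => ?_) l
    · exact ((convex_lexHalfPlane ..).inter (convex_lexHalfPlane ..)).inter
        (convex_lexHalfPlane ..)
    · exact h.convex_diff hK.convex hK.disjoint l
  · have hd : ∀ l, Disjoint centralTriangle (K l \ (centralTriangle ∪ trianglePoints)) := fun l =>
      disjoint_sdiff_right.mono_left subset_union_left
    intro l l'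
    refine Fin.cases ?_ (fun l => ?_) l <;> refine Fin.cases ?_ (fun l' => ?_) l' <;> intro hll
    · exact absurd rfl hll
    · exact hd l'
    · exact (hd l).symm
    · exact (hK.disjoint fun hl => hll (congrArg Fin.succ hl)).mono sdiff_le sdiff_le
  · rw [h.compl_iUnion_insertTriangle]
    exact (hK.finite.sdiff).union hfin
  · have h0 : ((0 : ℝ), (0 : ℝ)) ∈ (⋃ l, K l)ᶜ := by
      simpa using h.zero_notMem
    have hdisj : Disjoint ((⋃ l, K l)ᶜ \ {((0 : ℝ), (0 : ℝ))}) trianglePoints :=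
      Set.disjoint_left.2 fun x hx hx' => hx.1 (h.mem_iUnion (Or.inr hx') hx.2)
    have := ncard_sdiff_singleton_add_one h0 hK.finite
    rw [h.compl_iUnion_insertTriangle, ncard_union_eq hdisj hK.finite.sdiff hfin,
      ncard_trianglePoints]
    have := hK.ncard
    omega

/-- The affine coordinate change moving the vertex `(1, 0)` of the central triangle to the
origin. -/
noncomputable def vertexChart : ℝ × ℝ ≃ ℝ × ℝ where
  toFun x := (1 + (3 * x.1 - x.2) / 10, x.2 / 10)
  invFun y := ((10 * (y.1 - 1) + 10 * y.2) / 3, 10 * y.2)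
  left_inv x := by ext <;> simp <;> ring
  right_inv y := by ext <;> simp; ring

theorem vertexChart_apply (x : ℝ × ℝ) :
    vertexChart x = (1 + (3 * x.1 - x.2) / 10, x.2 / 10) := rfl

theorem IsTripod.insertTriangle {n : ℕ} {K : Fin n → Set (ℝ × ℝ)} {i j k : Fin n}
    (h : IsTripod K i j k) :
    IsTripod (fun l => vertexChart ⁻¹' insertTriangle K l) 0 j.succ k.succ := by
  refine ⟨?_, ?_, ?_, ?_, ?_⟩
  · intro l
    rw [mem_preimage, vertexChart_apply]
    refine Fin.cases ?_ (fun l => ?_) l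
    · rw [_root_.insertTriangle, Fin.cons_zero, mem_centralTriangle]
      norm_num
    · rw [_root_.insertTriangle, Fin.cons_succ]
      refine fun hx => hx.2 (Or.inr ?_)
      rw [mem_trianglePoints]
      norm_num
  · rintro ⟨a, b⟩ hx
    rw [mem_preimage, vertexChart_apply, _root_.insertTriangle, Fin.cons_zero,
      mem_centralTriangle] at hx
    grind
  · rintro ⟨a, b⟩ ⟨hx, hx'⟩
    have := h.subset_snd _ hx
    rw [vertexChart_apply] at this hx'
    simp only [mem_union, mem_centralTriangle, mem_trianglePoints] at hx'
    grind
  · rintro ⟨a, b⟩ ⟨hx, hx'⟩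
    have := h.subset_trd _ hx
    rw [vertexChart_apply] at this hx'
    simp only [mem_union, mem_centralTriangle, mem_trianglePoints] at hx'
    grind
  · rintro ⟨a, b⟩ hx h1 h2 h3
    simp only [ne_eq, Prod.mk.injEq, not_and] at hx h1 h2 h3
    have hv : vertexChart (a, b) ∉ trianglePoints := by
      simp only [mem_trianglePoints, vertexChart_apply]
      grind
    have hi : vertexChart (a, b) ∉ K i := by
      intro hK
      have := (h.subset_fst _ hK).1
      simp only [vertexChart_apply] at this
      linarith
    have hc := h.cover (vertexChart (a, b))
      (by simp only [vertexChart_apply, ne_eq, Prod.mk.injEq]; grind)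
      (by simp only [vertexChart_apply]; linarith) (by simp only [vertexChart_apply]; linarith)
      (by simp only [vertexChart_apply]; linarith)
    simp only [mem_preimage, _root_.insertTriangle, Fin.cons_zero, Fin.cons_succ, mem_sdiff,
      mem_union]
    tauto

theorem exists_isConvexPacking_isTripod (n : ℕ) :
    ∃ K : Fin (n + 3) → Set (ℝ × ℝ), IsConvexPacking K (5 * n + 4) ∧
      ∃ i j k, IsTripod K i j k := by
  induction n with
  | zero =>
    exact ⟨puncturedSector, isConvexPacking_puncturedSector, 0, 1, 2, isTripod_puncturedSector⟩
  | succ n ih =>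
    obtain ⟨K, hK, i, j, k, h⟩ := ih
    refine ⟨fun l => vertexChart ⁻¹' insertTriangle K l, ?_, 0, j.succ, k.succ, h.insertTriangle⟩
    refine (h.isConvexPacking_insertTriangle hK).preimage vertexChart fun x y a b hab => ?_
    obtain rfl : b = 1 - a := by linarith
    ext <;> simp [vertexChart_apply] <;> ring

/-- For every `n ≥ 3` there exist pairwise disjoint convex sets `K₁, …, Kₙ` in the
plane whose complement `S` is finite with `|S| = 5n - 11`. -/
theorem exists_complement_disjoint_convex_plane_card_eq (n : ℕ) (hn : 3 ≤ n) :
    ∃ K : Fin n → Set (EuclideanSpace ℝ (Fin 2)),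
      (∀ i, Convex ℝ (K i)) ∧
      (Pairwise fun i j => Disjoint (K i) (K j)) ∧
      (⋃ i, K i)ᶜ.Finite ∧ (⋃ i, K i)ᶜ.ncard = 5 * n - 11 := by
  obtain ⟨n, rfl⟩ := Nat.exists_eq_add_of_le' hn
  obtain ⟨K, hK, -⟩ := exists_isConvexPacking_isTripod n
  let e : EuclideanSpace ℝ (Fin 2) ≃ₗ[ℝ] ℝ × ℝ :=
    (EuclideanSpace.equiv (Fin 2) ℝ).toLinearEquiv.trans (LinearEquiv.finTwoArrow ℝ ℝ)
  have := hK.preimage e.toEquiv fun x y a b _ => by simp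
  exact ⟨_, this.convex, this.disjoint, this.finite, by rw [this.ncard]; omega⟩
end

section
/- Let K₁, …, Kₙ ⊆ ℝ^d be convex sets and let S = ℝ^d \ (K₁ ∪ … ∪ Kₙ). Then there exists a finite collection C of affine subspaces (flats) of ℝ^d such that every point p ∈ S belongs to some flat F ∈ C whose dimension equals the local dimension dm(S, p). -/
open Metric Set Module

/-- `HasSimplex S k` : the set `S` contains a `k`-simplex, i.e. the convex hull
of `k+1` affinely independent points. -/
def HasSimplex {d : ℕ} (S : Set (EuclideanSpace ℝ (Fin d))) (k : ℕ) : Prop :=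
  ∃ f : Fin (k + 1) → EuclideanSpace ℝ (Fin d),
    AffineIndependent ℝ f ∧ convexHull ℝ (Set.range f) ⊆ S

/-- The flat-dimension `dm S` of a set `S ⊆ ℝ^d`: the maximal `k` such that `S`
contains a `k`-simplex. -/
noncomputable def dm {d : ℕ} (S : Set (EuclideanSpace ℝ (Fin d))) : ℕ :=
  sSup {k : ℕ | HasSimplex S k}

/-- The local dimension `dmLoc S p` of `S` at `p`: the minimum over `ε > 0` of
the flat-dimension of `S ∩ B(p, ε)`. -/
noncomputable def dmLoc {d : ℕ} (S : Set (EuclideanSpace ℝ (Fin d)))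
    (p : EuclideanSpace ℝ (Fin d)) : ℕ :=
  sInf {m : ℕ | ∃ ε > 0, m = dm (S ∩ ball p ε)}

/-- `p` is a `k`-ordinary point of `S`: its local dimension is `k` and, near `p`,
`S` coincides with a `k`-flat. -/
def IsOrdinaryPoint {d : ℕ} (S : Set (EuclideanSpace ℝ (Fin d))) (k : ℕ)
    (p : EuclideanSpace ℝ (Fin d)) : Prop :=
  p ∈ S ∧ dmLoc S p = k ∧
    ∃ H : AffineSubspace ℝ (EuclideanSpace ℝ (Fin d)),
      finrank ℝ H.direction = k ∧
      ∃ U, IsOpen U ∧ p ∈ U ∧ S ∩ U = (H : Set (EuclideanSpace ℝ (Fin d))) ∩ U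

/-- `H` is a `k`-ordinary flat of `S`: `H` is a `k`-flat which witnesses some
`k`-ordinary point of `S`. -/
def IsOrdinaryFlat {d : ℕ} (S : Set (EuclideanSpace ℝ (Fin d))) (k : ℕ)
    (H : AffineSubspace ℝ (EuclideanSpace ℝ (Fin d))) : Prop :=
  finrank ℝ H.direction = k ∧
    ∃ p ∈ S, dmLoc S p = k ∧
      ∃ U, IsOpen U ∧ p ∈ U ∧ S ∩ U = (H : Set (EuclideanSpace ℝ (Fin d))) ∩ U

/-- A convex set covered by a flat and a closed set is contained in one of them. -/
theorem Convex.subset_or_subset_of_subset_affineSubspace_union {E : Type*}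
    [NormedAddCommGroup E] [NormedSpace ℝ E] {C : Set E} (hC : Convex ℝ C) (B : AffineSubspace ℝ E)
    {R : Set E} (hR : IsClosed R) (h : C ⊆ B ∪ R) :
    C ⊆ B ∨ C ⊆ R := by
  refine or_iff_not_imp_left.2 fun hCB => ?_
  obtain ⟨x, hxC, hxB⟩ := not_subset.1 hCB
  intro y hyC
  by_cases hyB : y ∈ B
  swap
  · exact (h hyC).resolve_left hyB
  have hcont : Filter.Tendsto (fun t : ℝ => AffineMap.lineMap y x t) (nhdsWithin 0 (Ioi 0))
      (nhds y) := by
    have : Continuous fun t : ℝ => AffineMap.lineMap y x t := AffineMap.lineMap_continuous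
    simpa using (this.tendsto 0).mono_left nhdsWithin_le_nhds
  refine hR.mem_of_tendsto hcont ?_
  filter_upwards [Ioo_mem_nhdsGT (zero_lt_one' ℝ)] with t ht
  refine (h (hC.lineMap_mem hyC hxC ⟨ht.1.le, ht.2.le⟩)).resolve_left fun hB => hxB ?_
  have := AffineMap.lineMap_mem t⁻¹ hyB hB
  rwa [AffineMap.lineMap_lineMap_right, inv_mul_cancel₀ ht.1.ne', AffineMap.lineMap_apply_one]
    at this

section Separation

variable {E : Type*} [NormedAddCommGroup E] [NormedSpace ℝ E] [FiniteDimensional ℝ E]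

/-- In finite dimension a nonempty convex set can be weakly separated from any point outside it
by a nonzero functional. -/
theorem Convex.exists_ne_zero_forall_le_of_notMem {K : Set E} (hK : Convex ℝ K)
    (hne : K.Nonempty) {p : E} (hp : p ∉ K) : ∃ f : E →L[ℝ] ℝ, f ≠ 0 ∧ ∀ x ∈ K, f x ≤ f p := by
  by_cases hint : (interior K).Nonempty
  · obtain ⟨f, hf⟩ := geometric_hahn_banach_open_point hK.interior isOpen_interior
      (fun h => hp (interior_subset h))
    obtain ⟨y, hy⟩ := hint
    refine ⟨f, ?_, fun x hx => ?_⟩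
    · rintro rfl
      simpa using hf y hy
    · have hcl : closure (interior K) ⊆ {x | f x ≤ f p} :=
        closure_minimal (fun z hz => (hf z hz).le) (isClosed_le f.continuous continuous_const)
      rw [hK.closure_interior_eq_closure_of_nonempty_interior ⟨y, hy⟩] at hcl
      exact hcl (subset_closure hx)
  · obtain ⟨y, hy⟩ := hne
    have hspan : affineSpan ℝ K ≠ ⊤ := fun h =>
      hint (hK.interior_nonempty_iff_affineSpan_eq_top.2 h)
    have hdir : (affineSpan ℝ K).direction < ⊤ := by
      refine lt_top_iff_ne_top.2 fun h => hspan ?_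
      rwa [AffineSubspace.direction_eq_top_iff_of_nonempty ⟨y, subset_affineSpan ℝ K hy⟩] at h
    obtain ⟨f, hf0, hf⟩ := Submodule.exists_le_ker_of_lt_top _ hdir
    have hconst : ∀ x ∈ K, f x = f y := fun x hx => by
      have : x - y ∈ LinearMap.ker f := hf (AffineSubspace.vsub_mem_direction
        (subset_affineSpan ℝ K hx) (subset_affineSpan ℝ K hy))
      rwa [LinearMap.mem_ker, map_sub, sub_eq_zero] at this
    have hF0 : LinearMap.toContinuousLinearMap f ≠ 0 := by simpa using hf0
    rcases le_total (f y) (f p) with h | h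
    · exact ⟨LinearMap.toContinuousLinearMap f, hF0, fun x hx => by simpa [hconst x hx] using h⟩
    · exact ⟨-LinearMap.toContinuousLinearMap f, neg_ne_zero.2 hF0,
        fun x hx => by simpa [hconst x hx] using h⟩

/-- Weak separation of a convex set from a point inside a flat `A`: the functional is not
constant on `A`. -/
theorem Convex.exists_forall_le_of_notMem_of_mem_affineSubspace {K : Set E} (hK : Convex ℝ K)
    (A : AffineSubspace ℝ E) {p : E} (hpA : p ∈ A) (hne : (K ∩ A).Nonempty) (hp : p ∉ K) :
    ∃ f : E →L[ℝ] ℝ, (∃ x ∈ A, f x ≠ f p) ∧ ∀ x ∈ K ∩ A, f x ≤ f p := by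
  have hconv : Convex ℝ {v : A.direction | (v : E) + p ∈ K} := by
    have := (hK.translate_preimage_left p).linear_preimage A.direction.subtype
    exact this
  obtain ⟨y, hyK, hyA⟩ := hne
  obtain ⟨g, hg0, hg⟩ := hconv.exists_ne_zero_forall_le_of_notMem (p := 0)
    ⟨⟨y - p, A.vsub_mem_direction hyA hpA⟩, by simpa using hyK⟩ (by simpa using hp)
  obtain ⟨f, hf⟩ := LinearMap.exists_extend (g : A.direction →ₗ[ℝ] ℝ)
  have hfg : ∀ v : A.direction, f v = g v := fun v => LinearMap.congr_fun hf v
  refine ⟨LinearMap.toContinuousLinearMap f, ?_, fun x hx => ?_⟩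
  · obtain ⟨v, hv⟩ : ∃ v, g v ≠ 0 := by
      by_contra! h
      exact hg0 (ContinuousLinearMap.ext h)
    exact ⟨(v : E) + p, A.vadd_mem_of_mem_direction v.2 hpA, by simpa [hfg] using hv⟩
  · have := hg ⟨x - p, A.vsub_mem_direction hx.2 hpA⟩ (by simpa using hx.1)
    rw [map_zero, ← hfg] at this
    simpa using this

/-- The section of a flat `A` by a level set of a functional that is not constant on `A` is a
flat of smaller dimension. -/
theorem AffineSubspace.exists_finrank_direction_lt_of_not_const (A : AffineSubspace ℝ E)
    {p : E} (hpA : p ∈ A) (f : E →L[ℝ] ℝ) (hf : ∃ x ∈ A, f x ≠ f p) :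
    ∃ B ≤ A, finrank ℝ B.direction < finrank ℝ A.direction ∧ ∀ x ∈ A, f x = f p → x ∈ B := by
  have hmem : ∀ x, x ∈ A ⊓ AffineSubspace.mk' p (LinearMap.ker (f : E →ₗ[ℝ] ℝ)) ↔
      x ∈ A ∧ f x = f p := fun x => by
    simp [AffineSubspace.mem_inf_iff, AffineSubspace.mem_mk', sub_eq_zero]
  refine ⟨_, inf_le_left, Submodule.finrank_lt_finrank_of_lt
    (AffineSubspace.direction_lt_of_nonempty (lt_of_le_of_ne inf_le_left ?_)
      ⟨p, (hmem p).2 ⟨hpA, rfl⟩⟩), fun x hx h => (hmem x).2 ⟨hx, h⟩⟩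
  obtain ⟨x, hxA, hx⟩ := hf
  intro h
  exact hx ((hmem x).1 (h.symm.le hxA)).2

/-- Inside a flat `A`, consider the points lying in none of the convex sets `K i`, but having a
neighbourhood covered by the closures of the `K i`. Finitely many proper subflats of `A` cover
them. -/
theorem exists_finite_cover_of_locally_covered_by_closure {ι : Type*} [Finite ι] (K : ι → Set E)
    (hK : ∀ i, Convex ℝ (K i)) (A : AffineSubspace ℝ E) :
    ∃ C : Set (AffineSubspace ℝ E), C.Finite ∧
      (∀ B ∈ C, B ≤ A ∧ finrank ℝ B.direction < finrank ℝ A.direction) ∧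
      ∀ p ∈ A, p ∉ ⋃ i, K i →
        (∃ ε > 0, (A : Set E) ∩ ball p ε ⊆ ⋃ i, closure (K i ∩ A)) → ∃ B ∈ C, p ∈ B := by
  let I : E → Set ι := fun p => {i | p ∈ closure (K i ∩ A)}
  let T : Set E := {p | p ∈ A ∧ p ∉ ⋃ i, K i ∧
    ∃ ε > 0, (A : Set E) ∩ ball p ε ⊆ ⋃ i, closure (K i ∩ A)}
  suffices h : ∀ J : Set ι, ∃ C : Set (AffineSubspace ℝ E), C.Finite ∧
      (∀ B ∈ C, B ≤ A ∧ finrank ℝ B.direction < finrank ℝ A.direction) ∧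
      ∀ p ∈ T, I p = J → ∃ B ∈ C, p ∈ B by
    choose C hfin hlt hcov using h
    refine ⟨⋃ J, C J, Set.finite_iUnion hfin, ?_, fun p hpA hpK hε => ?_⟩
    · simp only [mem_iUnion]
      rintro B ⟨J, hB⟩
      exact hlt J B hB
    · obtain ⟨B, hB, hpB⟩ := hcov (I p) p ⟨hpA, hpK, hε⟩ rfl
      exact ⟨B, mem_iUnion.2 ⟨_, hB⟩, hpB⟩
  intro J
  by_cases hJ : ∃ p ∈ T, I p = J
  swap
  · exact ⟨∅, Set.finite_empty, by simp, fun p hp h => (hJ ⟨p, hp, h⟩).elim⟩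
  obtain ⟨p, ⟨hpA, hpK, ε, hε, hcov⟩, rfl⟩ := hJ
  have hsupp : ∀ j : I p, ∃ B ≤ A, finrank ℝ B.direction < finrank ℝ A.direction ∧
      ∀ t > (0 : ℝ), ∀ q ∈ A, q ∈ closure (K j ∩ A) →
        AffineMap.lineMap p q (-t) ∈ closure (K j ∩ A) → q ∈ B := by
    rintro ⟨j, hj⟩
    obtain ⟨f, hf, hle⟩ := (hK j).exists_forall_le_of_notMem_of_mem_affineSubspace A hpA
      (closure_nonempty_iff.1 ⟨p, hj⟩) (fun h => hpK (mem_iUnion.2 ⟨j, h⟩))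
    obtain ⟨B, hBA, hlt, hB⟩ := A.exists_finrank_direction_lt_of_not_const hpA f hf
    refine ⟨B, hBA, hlt, fun t ht q hqA hq hq' => hB q hqA ?_⟩
    have hcl : closure (K j ∩ A) ⊆ {x | f x ≤ f p} :=
      closure_minimal hle (isClosed_le f.continuous continuous_const)
    have h₁ : f q ≤ f p := hcl hq
    have h₂ : f (AffineMap.lineMap p q (-t)) ≤ f p := hcl hq'
    rw [AffineMap.lineMap_apply] at h₂
    simp only [vsub_eq_sub, vadd_eq_add, map_add, map_smul, map_sub, smul_eq_mul] at h₂
    nlinarith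
  choose B hBA hlt hB using hsupp
  refine ⟨range B, Set.finite_range B, ?_, ?_⟩
  · rintro _ ⟨j, rfl⟩
    exact ⟨hBA j, hlt j⟩
  rintro q ⟨hqA, -, -⟩ hqI
  have hnear : ∀ᶠ x in nhds p, x ∈ ball p ε ∧ ∀ i, x ∈ closure (K i ∩ A) → i ∈ I p := by
    refine Filter.Eventually.and (ball_mem_nhds p hε) (Filter.eventually_all.2 fun i => ?_)
    by_cases hi : i ∈ I p
    · exact Filter.Eventually.of_forall fun _ _ => hi
    · filter_upwards [isClosed_closure.isOpen_compl.mem_nhds hi] with x hx hx'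
      exact (hx hx').elim
  have hcont : Filter.Tendsto (fun t : ℝ => AffineMap.lineMap p q (-t)) (nhdsWithin 0 (Ioi 0))
      (nhds p) := by
    have : Continuous fun t : ℝ => AffineMap.lineMap p q (-t) :=
      AffineMap.lineMap_continuous.comp continuous_neg
    simpa using (this.tendsto 0).mono_left nhdsWithin_le_nhds
  obtain ⟨t, ⟨hball, hI⟩, ht⟩ := ((hcont.eventually hnear).and self_mem_nhdsWithin).exists
  obtain ⟨j, hj⟩ := mem_iUnion.1 (hcov ⟨AffineMap.lineMap_mem (-t) hpA hqA, hball⟩)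
  have hjp := hI j hj
  exact ⟨B ⟨j, hjp⟩, ⟨_, rfl⟩, hB ⟨j, hjp⟩ t ht q hqA (hqI.symm ▸ hjp : j ∈ I q) hj⟩

/-- A nonempty convex set covered by finitely many flats is contained in one of them. -/
theorem Convex.exists_subset_of_subset_biUnion_affineSubspace {C : Set E} (hC : Convex ℝ C)
    (hne : C.Nonempty) {F : Set (AffineSubspace ℝ E)} (hF : F.Finite)
    (h : C ⊆ ⋃ B ∈ F, (B : Set E)) : ∃ B ∈ F, C ⊆ B := by
  induction F, hF using Set.Finite.induction_on with
  | empty =>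
    obtain ⟨x, hx⟩ := hne
    simpa using h hx
  | @insert B F _ hF ih =>
    rw [biUnion_insert] at h
    rcases hC.subset_or_subset_of_subset_affineSubspace_union B
      (hF.isClosed_biUnion fun B _ => B.closed_of_finiteDimensional) h with h | h
    · exact ⟨B, mem_insert _ _, h⟩
    · obtain ⟨B', hB', h'⟩ := ih h
      exact ⟨B', mem_insert_of_mem _ hB', h'⟩

end Separation

section FlatDimension

variable {d : ℕ} {S T : Set (EuclideanSpace ℝ (Fin d))} {p : EuclideanSpace ℝ (Fin d)} {k : ℕ}

theorem HasSimplex.mono (h : HasSimplex S k) (hST : S ⊆ T) : HasSimplex T k :=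
  let ⟨f, hf, hS⟩ := h
  ⟨f, hf, hS.trans hST⟩

theorem HasSimplex.le_finrank_direction (h : HasSimplex S k)
    {A : AffineSubspace ℝ (EuclideanSpace ℝ (Fin d))} (hSA : S ⊆ A) :
    k ≤ finrank ℝ A.direction := by
  obtain ⟨f, hf, hS⟩ := h
  rw [← hf.finrank_vectorSpan (Fintype.card_fin _), ← direction_affineSpan]
  exact Submodule.finrank_mono (AffineSubspace.direction_le
    (affineSpan_le.2 ((subset_convexHull ℝ _).trans (hS.trans hSA))))

theorem bddAbove_hasSimplex (S : Set (EuclideanSpace ℝ (Fin d))) :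
    BddAbove {k | HasSimplex S k} :=
  ⟨_, fun _ h => h.le_finrank_direction (A := ⊤) (by simp)⟩

theorem HasSimplex.le_dm (h : HasSimplex S k) : k ≤ dm S :=
  le_csSup (bddAbove_hasSimplex S) h

theorem hasSimplex_dm (hS : S.Nonempty) : HasSimplex S (dm S) := by
  obtain ⟨x, hx⟩ := hS
  refine Nat.sSup_mem (s := {k | HasSimplex S k}) ⟨0, fun _ => x, ?_, ?_⟩ (bddAbove_hasSimplex S)
  · have : Subsingleton (Fin (0 + 1)) := inferInstanceAs (Subsingleton (Fin 1))
    exact affineIndependent_of_subsingleton ℝ _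
  · simpa using hx

theorem dm_mono (hS : S.Nonempty) (hST : S ⊆ T) : dm S ≤ dm T :=
  ((hasSimplex_dm hS).mono hST).le_dm

/-- A flat contains simplices of full dimension around each of its points. -/
theorem hasSimplex_affineSubspace_inter_ball (A : AffineSubspace ℝ (EuclideanSpace ℝ (Fin d)))
    (hp : p ∈ A) {ε : ℝ} (hε : 0 < ε) :
    HasSimplex ((A : Set (EuclideanSpace ℝ (Fin d))) ∩ ball p ε) (finrank ℝ A.direction) := by
  obtain ⟨b, -, hb⟩ := exists_mem_interior_convexHull_affineBasis
    (ball_mem_nhds (0 : A.direction) hε)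
  let φ : A.direction →ᵃ[ℝ] EuclideanSpace ℝ (Fin d) :=
    A.direction.subtype.toAffineMap + AffineMap.const ℝ _ p
  have hφ : ∀ v, φ v = (v : EuclideanSpace ℝ (Fin d)) + p := fun v => rfl
  refine ⟨φ ∘ b, b.ind.map' φ fun v w h => ?_, ?_⟩
  · simpa [hφ] using h
  · rw [range_comp, ← AffineMap.image_convexHull]
    rintro _ ⟨v, hv, rfl⟩
    refine ⟨A.vadd_mem_of_mem_direction v.2 hp, ?_⟩
    have := hb hv
    rw [mem_ball_zero_iff] at this
    simpa [hφ] using this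

/-- The local dimension is the flat-dimension of every sufficiently small neighbourhood. -/
theorem exists_forall_dm_inter_ball_eq_dmLoc (hp : p ∈ S) :
    ∃ r > 0, ∀ ε > 0, ε ≤ r → dm (S ∩ ball p ε) = dmLoc S p := by
  obtain ⟨r, hr, h⟩ : dmLoc S p ∈ {m : ℕ | ∃ ε > 0, m = dm (S ∩ ball p ε)} :=
    Nat.sInf_mem ⟨_, 1, one_pos, rfl⟩
  refine ⟨r, hr, fun ε hε hεr => le_antisymm ?_ (Nat.sInf_le ⟨ε, hε, rfl⟩)⟩
  rw [h]
  exact dm_mono ⟨p, hp, mem_ball_self hε⟩ (inter_subset_inter_right _ (ball_subset_ball hεr))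

theorem dmLoc_eq_of_forall {r : ℝ} (hp : p ∈ S) (hr : 0 < r)
    (h : ∀ ε > 0, ε ≤ r → dm (S ∩ ball p ε) = k) : dmLoc S p = k := by
  obtain ⟨s, hs, h'⟩ := exists_forall_dm_inter_ball_eq_dmLoc hp
  rw [← h' _ (lt_min hr hs) (min_le_right _ _), h _ (lt_min hr hs) (min_le_left _ _)]

/-- If, inside the flat `A`, the complement of the sets `K i` contains no full-dimensional simplex
near `p`, then the closures of the `K i` cover `A` near `p`. -/
theorem inter_ball_subset_iUnion_closure_of_not_hasSimplex {ι : Type*} [Finite ι]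
    (K : ι → Set (EuclideanSpace ℝ (Fin d))) (A : AffineSubspace ℝ (EuclideanSpace ℝ (Fin d)))
    {ε : ℝ} (h : ¬ HasSimplex ((⋃ i, K i)ᶜ ∩ A ∩ ball p ε) (finrank ℝ A.direction)) :
    (A : Set (EuclideanSpace ℝ (Fin d))) ∩ ball p ε ⊆ ⋃ i, closure (K i ∩ A) := by
  rintro x ⟨hxA, hx⟩
  by_contra hxK
  have hopen : IsOpen ((⋃ i, closure (K i ∩ A))ᶜ ∩ ball p ε) :=
    (isClosed_iUnion_of_finite fun _ => isClosed_closure).isOpen_compl.inter isOpen_ball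
  obtain ⟨δ, hδ, hsub⟩ := Metric.isOpen_iff.1 hopen x ⟨hxK, hx⟩
  refine h ((hasSimplex_affineSubspace_inter_ball A hxA hδ).mono ?_)
  rintro y ⟨hyA, hy⟩
  refine ⟨⟨fun hyK => (hsub hy).1 ?_, hyA⟩, (hsub hy).2⟩
  obtain ⟨i, hi⟩ := mem_iUnion.1 hyK
  exact mem_iUnion.2 ⟨i, subset_closure ⟨hi, hyA⟩⟩

/-- If finitely many flats cover `S` near `p`, then one of them contains `p` and meets `S` in a set
of the same local dimension at `p`. -/
theorem exists_dmLoc_inter_eq_of_inter_ball_subset {F : Set (AffineSubspace ℝ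
    (EuclideanSpace ℝ (Fin d)))} (hF : F.Finite) (hp : p ∈ S) {r : ℝ} (hr : 0 < r)
    (hcov : S ∩ ball p r ⊆ ⋃ B ∈ F, (B : Set (EuclideanSpace ℝ (Fin d)))) :
    ∃ B ∈ F, p ∈ B ∧ dmLoc (S ∩ B) p = dmLoc S p := by
  obtain ⟨s, hs, hdm⟩ := exists_forall_dm_inter_ball_eq_dmLoc hp
  have hex : ∀ ε > 0, ε ≤ min r s → ∃ B ∈ F, HasSimplex (S ∩ B ∩ ball p ε) (dmLoc S p) := by
    intro ε hε hεr
    obtain ⟨f, hf, hfS⟩ := hdm ε hε (hεr.trans (min_le_right _ _)) ▸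
      hasSimplex_dm (S := S ∩ ball p ε) ⟨p, hp, mem_ball_self hε⟩
    obtain ⟨B, hB, hfB⟩ := (convex_convexHull ℝ (range f))
      |>.exists_subset_of_subset_biUnion_affineSubspace (range_nonempty f).convexHull hF
        ((hfS.trans (inter_subset_inter_right _
          (ball_subset_ball (hεr.trans (min_le_left _ _))))).trans hcov)
    exact ⟨B, hB, f, hf, fun x hx => ⟨⟨(hfS hx).1, hfB hx⟩, (hfS hx).2⟩⟩
  obtain ⟨B, hB, hBs⟩ : ∃ B ∈ F, ∀ ε > 0, HasSimplex (S ∩ B ∩ ball p ε) (dmLoc S p) := by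
    by_contra! hcon
    have hev : ∀ᶠ ε in nhdsWithin (0 : ℝ) (Ioi 0), ∀ B ∈ F,
        ¬ HasSimplex (S ∩ B ∩ ball p ε) (dmLoc S p) := by
      refine (Filter.eventually_all_finite hF).2 fun B hB => ?_
      obtain ⟨δ, hδ, hno⟩ := hcon B hB
      filter_upwards [Ioo_mem_nhdsGT hδ] with ε hε hε'
      exact hno (hε'.mono (inter_subset_inter_right _ (ball_subset_ball hε.2.le)))
    obtain ⟨ε, hno, hε⟩ := (hev.and (Ioo_mem_nhdsGT (lt_min hr hs))).exists
    obtain ⟨B, hB, h⟩ := hex ε hε.1 hε.2.le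
    exact hno B hB h
  have hpB : p ∈ B := by
    have : p ∈ closure (B : Set (EuclideanSpace ℝ (Fin d))) := by
      refine Metric.mem_closure_iff.2 fun ε hε => ?_
      obtain ⟨f, -, hf⟩ := hBs ε hε
      have := hf (subset_convexHull ℝ _ (mem_range_self 0))
      exact ⟨f 0, this.1.2, by simpa [dist_comm] using this.2⟩
    rwa [B.closed_of_finiteDimensional.closure_eq] at this
  refine ⟨B, hB, hpB, dmLoc_eq_of_forall ⟨hp, hpB⟩ hs fun ε hε hεs => le_antisymm ?_
    (hBs ε hε).le_dm⟩
  rw [← hdm ε hε hεs]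
  exact dm_mono ⟨p, ⟨hp, hpB⟩, mem_ball_self hε⟩
    (inter_subset_inter_left _ inter_subset_left)

/-- The relative version, inside a flat `A`, of the finite flat cover. -/
theorem exists_finite_flat_cover_inter {ι : Type*} [Finite ι]
    (K : ι → Set (EuclideanSpace ℝ (Fin d))) (hK : ∀ i, Convex ℝ (K i))
    (A : AffineSubspace ℝ (EuclideanSpace ℝ (Fin d))) :
    ∃ C : Set (AffineSubspace ℝ (EuclideanSpace ℝ (Fin d))), C.Finite ∧
      ∀ p ∈ (⋃ i, K i)ᶜ ∩ A, ∃ F ∈ C, p ∈ F ∧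
        finrank ℝ F.direction = dmLoc ((⋃ i, K i)ᶜ ∩ A) p := by
  induction hm : finrank ℝ A.direction using Nat.strong_induction_on generalizing A with
  | _ m ih =>
  obtain ⟨F, hF, hFA, hcov⟩ := exists_finite_cover_of_locally_covered_by_closure K hK A
  have hC : ∀ B : F, ∃ C : Set (AffineSubspace ℝ (EuclideanSpace ℝ (Fin d))), C.Finite ∧
      ∀ p ∈ (⋃ i, K i)ᶜ ∩ B, ∃ F ∈ C, p ∈ F ∧
        finrank ℝ F.direction = dmLoc ((⋃ i, K i)ᶜ ∩ B) p :=
    fun B => ih _ (hm ▸ (hFA B B.2).2) B rfl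
  choose C hCfin hC using hC
  have := hF.to_subtype
  refine ⟨insert A (⋃ B, C B), (Set.finite_iUnion hCfin).insert A, fun p hp => ?_⟩
  obtain ⟨r, hr, hdm⟩ := exists_forall_dm_inter_ball_eq_dmLoc hp
  have hle : dmLoc ((⋃ i, K i)ᶜ ∩ A) p ≤ m := by
    rw [← hdm r hr le_rfl, ← hm]
    exact (hasSimplex_dm (S := (⋃ i, K i)ᶜ ∩ A ∩ ball p r)
      ⟨p, hp, mem_ball_self hr⟩).le_finrank_direction (inter_subset_left.trans inter_subset_right)
  rcases hle.eq_or_lt with heq | hlt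
  · exact ⟨A, mem_insert _ _, hp.2, hm.trans heq.symm⟩
  have hsub : (⋃ i, K i)ᶜ ∩ A ∩ ball p r ⊆ ⋃ B ∈ F, (B : Set (EuclideanSpace ℝ (Fin d))) := by
    rintro q ⟨hq, hqr⟩
    obtain ⟨δ, hδ, hδr⟩ := Metric.isOpen_iff.1 isOpen_ball q hqr
    obtain ⟨B, hB, hqB⟩ := hcov q hq.2 hq.1 ⟨δ, hδ,
      inter_ball_subset_iUnion_closure_of_not_hasSimplex K A fun h => by
        have := (h.mono (inter_subset_inter_right _ hδr)).le_dm
        rw [hdm r hr le_rfl] at this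
        omega⟩
    exact mem_biUnion hB hqB
  obtain ⟨B, hB, hpB, hloc⟩ := exists_dmLoc_inter_eq_of_inter_ball_subset hF hp hr hsub
  have hAB : (⋃ i, K i)ᶜ ∩ (A : Set (EuclideanSpace ℝ (Fin d))) ∩ B = (⋃ i, K i)ᶜ ∩ B := by
    have hBA : (B : Set (EuclideanSpace ℝ (Fin d))) ⊆ A := (hFA B hB).1
    rw [inter_assoc, inter_eq_self_of_subset_right hBA]
  obtain ⟨G, hG, hpG, hdim⟩ := hC ⟨B, hB⟩ p ⟨hp.1, hpB⟩
  exact ⟨G, mem_insert_of_mem _ (mem_iUnion.2 ⟨_, hG⟩), hpG, by rw [hdim, ← hloc, hAB]⟩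

end FlatDimension

/-- The complement `S` of a finite union of convex sets in `ℝ^d` can be covered by
finitely many flats so that each `p ∈ S` lies on a flat of dimension `dmLoc S p`. -/
theorem exists_finite_flat_cover (d n : ℕ)
    (K : Fin n → Set (EuclideanSpace ℝ (Fin d))) (hK : ∀ i, Convex ℝ (K i)) :
    ∃ C : Set (AffineSubspace ℝ (EuclideanSpace ℝ (Fin d))), C.Finite ∧
      ∀ p ∈ (⋃ i, K i)ᶜ, ∃ F ∈ C, p ∈ F ∧
        Module.finrank ℝ F.direction = dmLoc (⋃ i, K i)ᶜ p := by
  simpa only [AffineSubspace.top_coe, inter_univ] using exists_finite_flat_cover_inter K hK ⊤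
end

section
/- Let K₁, …, Kₙ ⊆ ℝ^d be convex sets and let S = ℝ^d \ (K₁ ∪ … ∪ Kₙ). Then for every 0 ≤ k ≤ d, the collection of k-ordinary flats of S is finite. -/
open Metric Set Module

/-- Among the points of a nonempty set, the finitely many closed sets `C i` cut out locally the
same incidence pattern near a suitable point. -/
lemma exists_isOpen_incidence_eq {X ι : Type*} [TopologicalSpace X] [Finite ι]
    {C : ι → Set X} (hC : ∀ i, IsClosed (C i)) {A : Set X} (hA : A.Nonempty) :
    ∃ p ∈ A, ∃ V, IsOpen V ∧ p ∈ V ∧ ∀ x ∈ A ∩ V, {i | x ∈ C i} = {i | p ∈ C i} := by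
  obtain ⟨T, ⟨p, hp, rfl⟩, hmin⟩ :=
    (Set.toFinite ((fun x ↦ {i | x ∈ C i}) '' A)).exists_minimal (hA.image _)
  refine ⟨p, hp, ⋂ i ∈ {i | p ∉ C i}, (C i)ᶜ, ?_, by simp, fun x hx ↦ ?_⟩
  · exact (Set.toFinite _).isOpen_biInter fun i _ ↦ (hC i).isOpen_compl
  · have hsub : {i | x ∈ C i} ⊆ {i | p ∈ C i} := by
      intro i hi
      by_contra hpi
      exact Set.mem_iInter₂.1 hx.2 i hpi hi
    exact hsub.antisymm (hmin ⟨x, hx.1, rfl⟩ hsub)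

section NormedSpace

variable {E : Type*} [NormedAddCommGroup E] [NormedSpace ℝ E]

/-- The affine subspaces which agree with `S` near at least one of their points. -/
def locallyEqualFlats (S : Set E) : Set (AffineSubspace ℝ E) :=
  {H | ∃ p ∈ H, ∃ U, IsOpen U ∧ p ∈ U ∧ S ∩ U = (H : Set E) ∩ U}

lemma AffineSubspace.le_affineSpan_inter_isOpen (H : AffineSubspace ℝ E) {U : Set E}
    (hU : IsOpen U) {p : E} (hpH : p ∈ H) (hpU : p ∈ U) :
    H ≤ affineSpan ℝ ((H : Set E) ∩ U) := by
  intro x hx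
  have hcont : Filter.Tendsto (fun t : ℝ ↦ AffineMap.lineMap p x t) (nhdsWithin 0 {0}ᶜ)
      (nhds p) := by
    have h : Continuous fun t : ℝ ↦ AffineMap.lineMap p x t := AffineMap.lineMap_continuous
    simpa using (h.tendsto 0).mono_left nhdsWithin_le_nhds
  obtain ⟨t, htU, ht⟩ :=
    ((hcont.eventually (hU.mem_nhds hpU)).and self_mem_nhdsWithin).exists
  have hy : AffineMap.lineMap p x t ∈ affineSpan ℝ ((H : Set E) ∩ U) :=
    subset_affineSpan ℝ _ ⟨AffineMap.lineMap_mem t hpH hx, htU⟩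
  have hp : p ∈ affineSpan ℝ ((H : Set E) ∩ U) := subset_affineSpan ℝ _ ⟨hpH, hpU⟩
  have ht0 : t ≠ 0 := ht
  have hxy : AffineMap.lineMap p (AffineMap.lineMap p x t) t⁻¹ = x := by
    simp [AffineMap.lineMap_apply, smul_smul, ht0]
  rw [← hxy]
  exact AffineMap.lineMap_mem _ hp hy

lemma Convex.interior_closure_subset [FiniteDimensional ℝ E] {C : Set E} (hC : Convex ℝ C) :
    interior (closure C) ⊆ C := by
  rcases (interior (closure C)).eq_empty_or_nonempty with h | h
  · simp [h]
  have hspan : affineSpan ℝ C = ⊤ := by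
    have hcl : closure C ⊆ affineSpan ℝ C :=
      closure_minimal (subset_affineSpan ℝ C) (AffineSubspace.closed_of_finiteDimensional _)
    rw [eq_top_iff, ← isOpen_interior.affineSpan_eq_top h]
    exact affineSpan_le.2 (interior_subset.trans hcl)
  rw [hC.interior_closure_eq_interior_of_nonempty_interior
    (hC.interior_nonempty_iff_affineSpan_eq_top.2 hspan)]
  exact interior_subset

/-- If infinitely many flats agree locally with the complement of a finite union of convex sets,
then infinitely many of them lie in a common proper affine subspace. -/
lemma exists_infinite_sSup_ne_top [FiniteDimensional ℝ E] {ι : Type*} [Finite ι]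
    {K : ι → Set E} (hK : ∀ i, Convex ℝ (K i)) (hinf : (locallyEqualFlats (⋃ i, K i)ᶜ).Infinite) :
    ∃ A ⊆ locallyEqualFlats (⋃ i, K i)ᶜ, A.Infinite ∧ sSup A ≠ ⊤ := by
  by_contra! hspan
  have hloc : ∀ H : locallyEqualFlats (⋃ i, K i)ᶜ, ∃ p ∈ (H : AffineSubspace ℝ E), ∃ U,
      IsOpen U ∧ p ∈ U ∧ (⋃ i, K i)ᶜ ∩ U = ((H : AffineSubspace ℝ E) : Set E) ∩ U ∧
      ∀ x ∈ ((H : AffineSubspace ℝ E) : Set E) ∩ U,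
        {i | x ∈ closure (K i)} = {i | p ∈ closure (K i)} := by
    rintro ⟨H, p, hpH, U, hU, hpU, hSU⟩
    obtain ⟨p', hp', V, hV, hpV, hconst⟩ :=
      exists_isOpen_incidence_eq (fun i ↦ isClosed_closure (s := K i))
        (A := (H : Set E) ∩ U) ⟨p, hpH, hpU⟩
    refine ⟨p', hp'.1, U ∩ V, hU.inter hV, ⟨hp'.2, hpV⟩, ?_, fun x hx ↦ ?_⟩
    · simp only [← Set.inter_assoc]
      exact congrArg (· ∩ V) hSU
    · exact hconst x ⟨⟨hx.1, hx.2.1⟩, hx.2.2⟩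
  choose p hpH U hU hpU hSU hconst using hloc
  have := hinf.to_subtype
  obtain ⟨T, hT⟩ := Finite.exists_infinite_fiber fun H ↦ {i | p H ∈ closure (K i)}
  set B := (fun H ↦ {i | p H ∈ closure (K i)}) ⁻¹' {T}
  have hBinf : B.Infinite := Set.infinite_coe_iff.1 hT
  have hBtop : sSup (Subtype.val '' B) = ⊤ :=
    hspan _ (by rintro _ ⟨H, -, rfl⟩; exact H.2) (hBinf.image Subtype.val_injective.injOn)
  set V : Set E := ⋃ H ∈ B, ((H : AffineSubspace ℝ E) : Set E) ∩ U H
  have hVspan : affineSpan ℝ V = ⊤ := by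
    rw [eq_top_iff, ← hBtop]
    refine sSup_le ?_
    rintro _ ⟨H, hH, rfl⟩
    exact ((H : AffineSubspace ℝ E).le_affineSpan_inter_isOpen (hU H) (hpH H) (hpU H)).trans
      (affineSpan_mono ℝ fun x hx ↦ Set.mem_iUnion₂.2 ⟨H, hH, hx⟩)
  have hne := interior_convexHull_nonempty_iff_affineSpan_eq_top.2 hVspan
  obtain ⟨H, hHB, hHtop⟩ : ∃ H ∈ B, (H : AffineSubspace ℝ E) ≠ ⊤ := by
    by_contra! h
    refine hBinf (Set.Subsingleton.finite fun x hx y hy ↦ Subtype.ext ?_)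
    rw [h x hx, h y hy]
  obtain ⟨q, hq, hqH⟩ : ∃ q ∈ interior (convexHull ℝ V), q ∉ (H : AffineSubspace ℝ E) := by
    by_contra! h
    apply hHtop
    rw [eq_top_iff, ← isOpen_interior.affineSpan_eq_top hne]
    exact affineSpan_le.2 h
  have htend : Filter.Tendsto (fun t : ℝ ↦ AffineMap.lineMap (p H) q t) (nhdsWithin 0 (Iio 0))
      (nhds (p H)) := by
    have h : Continuous fun t : ℝ ↦ AffineMap.lineMap (p H) q t := AffineMap.lineMap_continuous
    simpa using (h.tendsto 0).mono_left nhdsWithin_le_nhds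
  have hcover : ∀ᶠ t : ℝ in nhdsWithin 0 (Iio 0), ∃ i, AffineMap.lineMap (p H) q t ∈ K i := by
    filter_upwards [htend.eventually ((hU H).mem_nhds (hpU H)), self_mem_nhdsWithin] with t htU ht
    by_contra hno
    have hmem : AffineMap.lineMap (p H) q t ∈ ((H : AffineSubspace ℝ E) : Set E) ∩ U H := by
      rw [← hSU H]
      exact ⟨by simpa using hno, htU⟩
    have ht0 : t ≠ 0 := ne_of_lt ht
    have hqt : AffineMap.lineMap (p H) (AffineMap.lineMap (p H) q t) t⁻¹ = q := by
      simp [AffineMap.lineMap_apply, smul_smul, ht0]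
    exact hqH (hqt ▸ AffineMap.lineMap_mem _ (hpH H) hmem.1)
  obtain ⟨i, hi⟩ : ∃ i, ∃ᶠ t : ℝ in nhdsWithin 0 (Iio 0), AffineMap.lineMap (p H) q t ∈ K i := by
    by_contra! h
    obtain ⟨t, ⟨i, hi⟩, ht⟩ := (hcover.and (Filter.eventually_all.2 h)).exists
    exact ht i hi
  have hiT : i ∈ T := by
    rw [← show {i | p H ∈ closure (K i)} = T from hHB]
    exact mem_closure_of_frequently_of_tendsto hi htend
  have hVK : V ⊆ closure (K i) := by
    refine Set.iUnion₂_subset fun H' hH' x hx ↦ ?_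
    have : i ∈ {i | x ∈ closure (K i)} := by
      rw [hconst H' x hx, show {i | p H' ∈ closure (K i)} = T from hH']
      exact hiT
    exact this
  have hqK : q ∈ K i :=
    (hK i).interior_closure_subset (interior_mono (convexHull_min hVK (hK i).closure) hq)
  obtain ⟨t, htK, ht⟩ := (hi.and_eventually self_mem_nhdsWithin).exists
  have ht : t < 0 := ht
  have hpK : p H ∈ K i := by
    have hcomb := hK i htK hqK (a := 1 / (1 - t)) (b := -t / (1 - t))
      (by apply div_nonneg <;> linarith) (by apply div_nonneg <;> linarith)
      (by rw [← add_div, ← sub_eq_add_neg, div_self (by linarith)])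
    convert hcomb using 1
    have h1 : (1 - t) ≠ 0 := by linarith
    rw [AffineMap.lineMap_apply_module]
    match_scalars
    · field_simp
    · field_simp
      ring
  have hpS : p H ∈ (⋃ i, K i)ᶜ ∩ U H := by
    rw [hSU H]
    exact ⟨hpH H, hpU H⟩
  exact hpS.1 (Set.mem_iUnion.2 ⟨i, hpK⟩)

/-- Only finitely many affine subspaces agree locally with the complement of a finite union of
convex sets. -/
theorem locallyEqualFlats_compl_iUnion_finite {ι : Type*} [Finite ι] (m : ℕ) :
    ∀ {E : Type*} [NormedAddCommGroup E] [NormedSpace ℝ E] [FiniteDimensional ℝ E]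
      {K : ι → Set E}, finrank ℝ E = m → (∀ i, Convex ℝ (K i)) →
      (locallyEqualFlats (⋃ i, K i)ᶜ).Finite := by
  induction m using Nat.strong_induction_on with
  | _ m ih =>
  intro E _ _ _ K hm hK
  by_contra hinf
  obtain ⟨A, hA, hAinf, hAtop⟩ := exists_infinite_sSup_ne_top hK hinf
  set F := sSup A
  obtain ⟨H₀, hH₀⟩ := hAinf.nonempty
  obtain ⟨z, hz, -⟩ := hA hH₀
  have hzF : z ∈ F := le_sSup hH₀ hz
  let f : F.direction →ᵃ[ℝ] E :=
    F.direction.subtype.toAffineMap + AffineMap.const ℝ F.direction z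
  have hf : ∀ v, f v = v + z := fun v ↦ rfl
  have hfc : Continuous f := by
    simp only [funext hf]
    fun_prop
  have hrange : ∀ x ∈ F, ∃ v, f v = x := fun x hx ↦
    ⟨⟨x - z, F.vsub_mem_direction hx hzF⟩, by simp [hf]⟩
  have hlt : finrank ℝ F.direction < m := by
    rw [← hm]
    refine Submodule.finrank_lt fun h ↦ hAtop ?_
    exact (AffineSubspace.direction_eq_top_iff_of_nonempty ⟨z, hzF⟩).1 h
  have hfin := ih _ hlt (E := F.direction) (K := fun i ↦ f ⁻¹' K i) rfl
    fun i ↦ (hK i).affine_preimage f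
  refine hAinf (Set.Finite.of_finite_image (f := AffineSubspace.comap f) (hfin.subset ?_) ?_)
  · rintro _ ⟨H, hH, rfl⟩
    obtain ⟨p, hp, U, hU, hpU, hSU⟩ := hA hH
    obtain ⟨v, rfl⟩ := hrange p (le_sSup hH hp)
    refine ⟨v, hp, f ⁻¹' U, hU.preimage hfc, hpU, ?_⟩
    rw [← Set.preimage_iUnion, ← Set.preimage_compl, ← Set.preimage_inter, hSU]
    rfl
  · intro H hH H' hH' heq
    have hle : ∀ {H₁ H₂ : AffineSubspace ℝ E}, H₁ ∈ A → H₁.comap f = H₂.comap f → H₁ ≤ H₂ := by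
      intro H₁ H₂ h₁ h x hx
      obtain ⟨v, rfl⟩ := hrange x (le_sSup h₁ hx)
      have hv : v ∈ H₁.comap f := hx
      rw [h] at hv
      exact hv
    exact (hle hH heq).antisymm (hle hH' heq.symm)

end NormedSpace

/-- For each `0 ≤ k ≤ d`, the complement of a finite union of convex sets in `ℝ^d`
has only finitely many `k`-ordinary flats. -/
theorem ordinaryFlats_finite (d n k : ℕ) (hk : k ≤ d)
    (K : Fin n → Set (EuclideanSpace ℝ (Fin d))) (hK : ∀ i, Convex ℝ (K i)) :
    {H : AffineSubspace ℝ (EuclideanSpace ℝ (Fin d)) |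
      IsOrdinaryFlat (⋃ i, K i)ᶜ k H}.Finite := by
  refine (locallyEqualFlats_compl_iUnion_finite _ rfl hK).subset ?_
  rintro H ⟨-, p, hp, -, U, hU, hpU, hSU⟩
  have hpH : p ∈ (H : Set (EuclideanSpace ℝ (Fin d))) ∩ U := hSU ▸ ⟨hp, hpU⟩
  exact ⟨p, hpH.1, U, hU, hpU, hSU⟩
end

section
/- Let d ≥ 2, let K₁, …, Kₙ ⊆ ℝ^d be convex sets, and let S = ℝ^d \ (K₁ ∪ … ∪ Kₙ). Then the number of (d−1)-ordinary flats (ordinary hyperplanes) of S is at most C(n, 2) = n(n−1)/2. -/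
open Metric Set Module

/-- If finitely many closed sets cover the nonempty trace of an open set on `A`, then one of them
contains the nonempty trace of a smaller open set. -/
theorem exists_open_inter_subset_of_finite_closed_cover {X ι : Type*} [TopologicalSpace X]
    (A : Set X) (C : ι → Set X) (hC : ∀ i, IsClosed (C i)) (s : Finset ι) :
    ∀ U : Set X, IsOpen U → (A ∩ U).Nonempty → A ∩ U ⊆ ⋃ i ∈ s, C i →
      ∃ i, ∃ V, IsOpen V ∧ V ⊆ U ∧ (A ∩ V).Nonempty ∧ A ∩ V ⊆ C i := by
  classical
  induction s using Finset.induction_on with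
  | empty =>
    rintro U - ⟨x, hx⟩ hcov
    simpa using hcov hx
  | insert a s _ ih =>
    intro U hU hne hcov
    by_cases h : (A ∩ (U ∩ (C a)ᶜ)).Nonempty
    · obtain ⟨i, V, hV, hVU, hVne, hVC⟩ := ih (U ∩ (C a)ᶜ) (hU.inter (hC a).isOpen_compl) h (by
        rintro x ⟨hxA, hxU, hxa⟩
        have := hcov ⟨hxA, hxU⟩
        rw [Finset.set_biUnion_insert] at this
        exact this.resolve_left hxa)
      exact ⟨i, V, hV, hVU.trans inter_subset_left, hVne, hVC⟩
    · refine ⟨a, U, hU, subset_rfl, hne, fun x hx => ?_⟩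
      by_contra hxa
      exact h ⟨x, hx.1, hx.2, hxa⟩

section NormedSpace

variable {E ι : Type*} [NormedAddCommGroup E] [NormedSpace ℝ E]

open Topology in
/-- If finitely many sets cover the part of an open set on the positive side of a hyperplane, then
one of them accumulates, from that side, at a relatively open piece of the hyperplane. -/
theorem exists_open_inter_subset_closure_pos_side [Fintype ι] (K : ι → Set E) (f : E →L[ℝ] ℝ)
    (c : ℝ) (v : E) (hv : 0 < f v) (U : Set E) (hU : IsOpen U)
    (hne : ({x | f x = c} ∩ U).Nonempty) (hcov : ∀ x ∈ U, c < f x → x ∈ ⋃ i, K i) :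
    ∃ i, ∃ V, IsOpen V ∧ V ⊆ U ∧ ({x | f x = c} ∩ V).Nonempty ∧
      {x | f x = c} ∩ V ⊆ closure (K i ∩ {x | c < f x}) := by
  refine exists_open_inter_subset_of_finite_closed_cover _
    (fun i => closure (K i ∩ {x | c < f x})) (fun _ => isClosed_closure) Finset.univ U hU hne ?_
  rintro x ⟨hxc, hxU⟩
  simp only [Finset.mem_univ, iUnion_true]
  rw [← closure_iUnion_of_finite, ← iUnion_inter]
  have hlim : Filter.Tendsto (fun t : ℝ => x + t • v) (𝓝[>] 0) (𝓝 x) := by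
    have : Continuous fun t : ℝ => x + t • v := by fun_prop
    simpa using (this.tendsto 0).mono_left nhdsWithin_le_nhds
  refine mem_closure_of_tendsto hlim ?_
  filter_upwards [hlim.eventually_mem (hU.mem_nhds hxU), self_mem_nhdsWithin] with t htU ht
  have : c < f (x + t • v) := by
    have := mul_pos (mem_Ioi.mp ht) hv
    simp only [mem_ofPred_eq] at hxc
    simp only [map_add, map_smul, smul_eq_mul]
    linarith
  exact ⟨hcov _ htU this, this⟩

/-- A convex set that accumulates at a point of a hyperplane from the positive side, and misses
the hyperplane near that point, lies on the nonnegative side. -/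
theorem Convex.le_of_mem_closure_pos_side {K : Set E} (hK : Convex ℝ K) (f : E →L[ℝ] ℝ) {c : ℝ}
    {U : Set E} (hU : IsOpen U) (hmiss : ∀ x ∈ K, x ∈ U → f x ≠ c) {q : E} (hqU : q ∈ U)
    (hqc : f q = c) (hq : q ∈ closure (K ∩ {x | c < f x})) : ∀ x ∈ K, c ≤ f x := by
  intro x hx
  by_contra! hlt
  let t : E → ℝ := fun y => (c - f x) / (f y - f x)
  have ht : ContinuousAt t q :=
    ContinuousAt.div (by fun_prop) (by fun_prop) (by rw [hqc]; linarith)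
  have hg : ContinuousAt (fun y => x + t y • (y - x)) q := by fun_prop
  have htq : t q = 1 := by
    simp only [t, hqc]
    exact div_self (by linarith)
  have hgq : x + t q • (q - x) = q := by simp [htq]
  have hmem := hg.preimage_mem_nhds (by rw [hgq]; exact hU.mem_nhds hqU)
  obtain ⟨y, hyU, hyK, hyc⟩ := mem_closure_iff_nhds.mp hq _ hmem
  simp only [mem_ofPred_eq] at hyc
  have hpos : 0 < f y - f x := by linarith
  refine hmiss _ (hK.add_smul_sub_mem hx hyK ⟨?_, ?_⟩) hyU ?_
  · exact div_nonneg (by linarith) hpos.le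
  · exact (div_le_one hpos).mpr (by linarith)
  · simp only [map_add, map_smul, map_sub, smul_eq_mul, t]
    rw [div_mul_cancel₀ _ hpos.ne']
    ring

/-- The hyperplane `H` separates `A` from `B`, and a nonempty relatively open piece of `H` lies in
the closures of both. -/
def IsSeparatingInterface (A B : Set E) (H : AffineSubspace ℝ E) : Prop :=
  ∃ (f : E →L[ℝ] ℝ) (c : ℝ), (∀ x, x ∈ H ↔ f x = c) ∧ (∀ x ∈ A, c ≤ f x) ∧ (∀ x ∈ B, f x ≤ c) ∧
    ∃ V, IsOpen V ∧ ((H : Set E) ∩ V).Nonempty ∧ (H : Set E) ∩ V ⊆ closure A ∩ closure B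

theorem IsSeparatingInterface.symm {A B : Set E} {H : AffineSubspace ℝ E}
    (h : IsSeparatingInterface A B H) : IsSeparatingInterface B A H := by
  obtain ⟨f, c, hH, hA, hB, V, hV, hne, hsub⟩ := h
  refine ⟨-f, -c, ?_, ?_, ?_, V, hV, hne, hsub.trans (inter_comm _ _).subset⟩ <;> simpa

open Topology in
/-- An affine subspace containing a nonempty relatively open piece of `H` contains `H`. -/
theorem AffineSubspace.le_of_open_inter_subset {H H' : AffineSubspace ℝ E} {V : Set E}
    (hV : IsOpen V) (hne : ((H : Set E) ∩ V).Nonempty) (hsub : (H : Set E) ∩ V ⊆ H') :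
    H ≤ H' := by
  obtain ⟨q, hqH, hqV⟩ := hne
  intro x hx
  have hlim : Filter.Tendsto (fun t : ℝ => AffineMap.lineMap q x t) (𝓝[>] 0) (𝓝 q) := by
    have : Continuous fun t : ℝ => (AffineMap.lineMap q x t : E) := by fun_prop
    simpa using (this.tendsto 0).mono_left nhdsWithin_le_nhds
  obtain ⟨t, htV, ht⟩ :=
    ((hlim.eventually_mem (hV.mem_nhds hqV)).and self_mem_nhdsWithin).exists
  replace ht : 0 < t := ht
  have hmem : AffineMap.lineMap q x t ∈ H' := hsub ⟨AffineMap.lineMap_mem t hqH hx, htV⟩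
  have hx' : x = AffineMap.lineMap q (AffineMap.lineMap q x t : E) t⁻¹ := by
    simp [AffineMap.lineMap_apply, smul_smul, inv_mul_cancel₀ ht.ne']
  rw [hx']
  exact AffineMap.lineMap_mem _ (hsub ⟨hqH, hqV⟩) hmem

theorem IsSeparatingInterface.le {A B : Set E} {H H' : AffineSubspace ℝ E}
    (h : IsSeparatingInterface A B H) (h' : IsSeparatingInterface A B H') : H ≤ H' := by
  obtain ⟨-, -, -, -, -, V, hV, hne, hsub⟩ := h
  obtain ⟨f, c, hH', hA, hB, -⟩ := h'
  refine AffineSubspace.le_of_open_inter_subset hV hne fun x hx => (hH' x).mpr (le_antisymm ?_ ?_)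
  · exact closure_minimal hB (isClosed_le f.continuous continuous_const) (hsub hx).2
  · exact closure_minimal hA (isClosed_le continuous_const f.continuous) (hsub hx).1

theorem IsSeparatingInterface.unique {A B : Set E} {H H' : AffineSubspace ℝ E}
    (h : IsSeparatingInterface A B H) (h' : IsSeparatingInterface A B H') : H = H' :=
  le_antisymm (h.le h') (h'.le h)

/-- A hyperplane that locally coincides with the complement of a finite union of convex sets is
the interface of two of these sets. -/
theorem exists_ne_isSeparatingInterface [Fintype ι] {K : ι → Set E} (hK : ∀ i, Convex ℝ (K i))
    {H : AffineSubspace ℝ E} {f : E →L[ℝ] ℝ} {c : ℝ} (hH : ∀ x, x ∈ H ↔ f x = c) {v : E}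
    (hv : 0 < f v) {U : Set E} (hU : IsOpen U) (hne : ((H : Set E) ∩ U).Nonempty)
    (hUH : (⋃ i, K i)ᶜ ∩ U = (H : Set E) ∩ U) :
    ∃ i j, i ≠ j ∧ IsSeparatingInterface (K i) (K j) H := by
  have hHset : (H : Set E) = {x | f x = c} := Set.ext hH
  rw [hHset] at hne hUH
  have hcov : ∀ x ∈ U, f x ≠ c → x ∈ ⋃ i, K i := by
    intro x hx hxc
    by_contra hxK
    exact hxc (hUH.subset ⟨hxK, hx⟩).1
  have hmiss : ∀ i, ∀ x ∈ K i, x ∈ U → f x ≠ c := fun i x hxK hxU hxc =>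
    (hUH.superset ⟨hxc, hxU⟩).1 (mem_iUnion.mpr ⟨i, hxK⟩)
  obtain ⟨i, V, hV, hVU, hVne, hVi⟩ := exists_open_inter_subset_closure_pos_side K f c v hv U hU
    hne fun x hx hxc => hcov x hx hxc.ne'
  have hneg : {x | (-f) x = -c} = {x | f x = c} := by ext; simp
  obtain ⟨j, W, hW, hWV, hWne, hWj⟩ := exists_open_inter_subset_closure_pos_side K (-f) (-c) (-v)
    (by simpa using hv) V hV (by rwa [hneg]) fun x hx hxc =>
      hcov x (hVU hx) (by simp only [neg_apply] at hxc; linarith)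
  rw [hneg] at hWne hWj
  obtain ⟨q, hqc, hqW⟩ := id hWne
  have hqU := hVU (hWV hqW)
  have hqj := hWj ⟨hqc, hqW⟩
  have hi : ∀ x ∈ K i, c ≤ f x :=
    (hK i).le_of_mem_closure_pos_side f hU (hmiss i) hqU hqc (hVi ⟨hqc, hWV hqW⟩)
  have hj : ∀ x ∈ K j, -c ≤ (-f) x :=
    (hK j).le_of_mem_closure_pos_side (-f) hU (by simpa using hmiss j) hqU (by simpa using hqc) hqj
  refine ⟨i, j, ?_, f, c, hH, hi, by simpa using hj, W, hW, by rwa [hHset], ?_⟩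
  · rintro rfl
    obtain ⟨y, hyK, hyc⟩ := closure_nonempty_iff.mp ⟨q, hqj⟩
    have := hi y hyK
    simp only [mem_ofPred_eq, neg_apply] at hyc
    linarith
  · rw [hHset]
    exact fun x hx => ⟨closure_mono inter_subset_left (hVi ⟨hx.1, hWV hx.2⟩),
      closure_mono inter_subset_left (hWj hx)⟩

end NormedSpace

/-- A hyperplane of a Euclidean space is a level set of a nonzero linear functional. -/
theorem AffineSubspace.exists_levelSet_of_finrank_direction_add_one {E : Type*}
    [NormedAddCommGroup E] [InnerProductSpace ℝ E] [FiniteDimensional ℝ E]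
    {H : AffineSubspace ℝ E} (hH : finrank ℝ H.direction + 1 = finrank ℝ E) {p : E} (hp : p ∈ H) :
    ∃ (f : E →L[ℝ] ℝ) (v : E), 0 < f v ∧ ∀ x, x ∈ H ↔ f x = f p := by
  have hone : finrank ℝ H.directionᗮ = 1 := by
    have := H.direction.finrank_add_finrank_orthogonal
    omega
  obtain ⟨⟨v, hvmem⟩, hv0, hspan⟩ := finrank_eq_one_iff'.mp hone
  have hv : v ≠ 0 := fun h => hv0 (Subtype.ext h)
  refine ⟨innerSL ℝ v, v, by simpa using real_inner_self_pos.mpr hv, fun x => ?_⟩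
  rw [← AffineSubspace.vsub_right_mem_direction_iff_mem hp, vsub_eq_sub,
    ← H.direction.orthogonal_orthogonal, Submodule.mem_orthogonal]
  simp only [innerSL_apply_apply]
  rw [← sub_eq_zero, ← inner_sub_right]
  refine ⟨fun h => h v hvmem, fun h u hu => ?_⟩
  obtain ⟨r, hr⟩ := hspan ⟨u, hu⟩
  have hr' : r • v = u := congrArg Subtype.val hr
  rw [← hr', real_inner_smul_left, h, mul_zero]

theorem IsOrdinaryFlat.exists_ne_isSeparatingInterface {d n : ℕ} (hd : 1 ≤ d)
    {K : Fin n → Set (EuclideanSpace ℝ (Fin d))} (hK : ∀ i, Convex ℝ (K i))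
    {H : AffineSubspace ℝ (EuclideanSpace ℝ (Fin d))}
    (hH : IsOrdinaryFlat (⋃ i, K i)ᶜ (d - 1) H) :
    ∃ i j, i ≠ j ∧ IsSeparatingInterface (K i) (K j) H := by
  obtain ⟨hdim, p, hpS, -, U, hU, hpU, hUH⟩ := hH
  have hpH : p ∈ (H : Set _) ∩ U := hUH.subset ⟨hpS, hpU⟩
  obtain ⟨f, v, hv, hf⟩ := AffineSubspace.exists_levelSet_of_finrank_direction_add_one
    (H := H) (by rw [hdim, finrank_euclideanSpace_fin]; omega) hpH.1
  exact _root_.exists_ne_isSeparatingInterface hK hf hv hU ⟨p, hpH⟩ hUH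

/-- For `d ≥ 2`, the number of `(d-1)`-ordinary flats (ordinary hyperplanes) of the
complement of a union of `n` convex sets in `ℝ^d` is at most `C(n,2)`. -/
theorem ordinary_hyperplanes_card_le (d n : ℕ) (hd : 2 ≤ d)
    (K : Fin n → Set (EuclideanSpace ℝ (Fin d))) (hK : ∀ i, Convex ℝ (K i)) :
    {H : AffineSubspace ℝ (EuclideanSpace ℝ (Fin d)) |
      IsOrdinaryFlat (⋃ i, K i)ᶜ (d - 1) H}.encard ≤ (n.choose 2 : ℕ∞) := by
  have hpair : ∀ H : AffineSubspace ℝ (EuclideanSpace ℝ (Fin d)),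
      IsOrdinaryFlat (⋃ i, K i)ᶜ (d - 1) H → ∃ s : Finset (Fin n), s.card = 2 ∧
        ∃ i j, (s : Set (Fin n)) = {i, j} ∧ IsSeparatingInterface (K i) (K j) H := by
    intro H hH
    obtain ⟨i, j, hij, hsep⟩ := hH.exists_ne_isSeparatingInterface (by omega) hK
    exact ⟨{i, j}, Finset.card_pair hij, i, j, Finset.coe_pair, hsep⟩
  choose! s hs hsep using hpair
  have hcard : ((Finset.powersetCard 2 (Finset.univ : Finset (Fin n)) : Finset (Finset (Fin n))) :
      Set (Finset (Fin n))).encard = (n.choose 2 : ℕ∞) := by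
    rw [encard_coe_eq_coe_finsetCard, Finset.card_powersetCard, Finset.card_univ, Fintype.card_fin]
  rw [← hcard]
  refine encard_le_encard_of_injOn (f := s) (fun H hH => by simpa using hs H hH) ?_
  intro H hH H' hH' heq
  obtain ⟨i, j, hs₁, h⟩ := hsep H hH
  obtain ⟨i', j', hs₂, h'⟩ := hsep H' hH'
  rw [heq, hs₂] at hs₁
  rcases Set.pair_eq_pair_iff.mp hs₁ with ⟨rfl, rfl⟩ | ⟨rfl, rfl⟩
  · exact h.unique h'
  · exact h.symm.unique h'
end

section
/- Let K₁, …, Kₙ ⊆ ℝ² be convex sets and let S = ℝ² \ (K₁ ∪ … ∪ Kₙ). Then the number of 1-ordinary flats (ordinary lines) of S is at most the Turán number t(n, 4), the maximum number of edges in a simple graph on n vertices containing no complete subgraph on 5 vertices. -/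
open Metric Set Module

/-- The Turán number `t(n, 4)`: the maximum number of edges of a simple graph on
`n` vertices containing no complete subgraph on `5` vertices. -/
noncomputable def turanNumber4 (n : ℕ) : ℕ :=
  sSup {m : ℕ | ∃ G : SimpleGraph (Fin n), G.CliqueFree 5 ∧ m = G.edgeSet.ncard}

/-- The signed angle under which the directed segment from `z` to `w` is seen from `x`. -/
noncomputable def viewAngle (x z w : ℂ) : ℝ := Complex.arg ((w - x) / (z - x))

lemma div_sub_mem_slitPlane {x z w : ℂ} (hx : x ∉ segment ℝ z w) :
    (w - x) / (z - x) ∈ Complex.slitPlane := by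
  by_contra h
  apply hx
  rw [Complex.mem_slitPlane_iff, not_or, not_lt, not_not] at h
  have hzx : z - x ≠ 0 := by
    rintro h0
    rw [sub_eq_zero] at h0
    exact hx (h0 ▸ left_mem_segment ℝ z w)
  set r := (w - x) / (z - x) with hr
  have hr' : r = ((r.re : ℝ) : ℂ) := Complex.ext (by simp) (by simp [h.2])
  have hw : w - x = (r.re : ℂ) * (z - x) := by
    rw [← hr', hr, div_mul_cancel₀ _ hzx]
  have hpos : 0 < 1 - r.re := by linarith [h.1]
  have hne : (1 - (r.re : ℂ)) ≠ 0 := by exact_mod_cast hpos.ne'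
  refine ⟨-r.re / (1 - r.re), 1 / (1 - r.re), div_nonneg (by linarith [h.1]) hpos.le,
    by positivity, by field_simp; ring, ?_⟩
  rw [Complex.real_smul, Complex.real_smul]
  push_cast
  field_simp
  linear_combination hw

lemma continuousAt_viewAngle {x z w : ℂ} (hx : x ∉ segment ℝ z w) :
    ContinuousAt (fun y => viewAngle y z w) x := by
  have hzx : z - x ≠ 0 := by
    rintro h0
    rw [sub_eq_zero] at h0
    exact hx (h0 ▸ left_mem_segment ℝ z w)
  exact (Complex.continuousAt_arg (div_sub_mem_slitPlane hx)).comp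
    (f := fun y => (w - y) / (z - y)) (by fun_prop (disch := assumption))

/-- The total angle swept by a closed polygon is a multiple of `2π`. -/
lemma sum_viewAngle_mem_zmultiples {m : ℕ} (z : Fin (m + 1) → ℂ) {x : ℂ} (hx : ∀ k, z k ≠ x) :
    ∑ k, viewAngle x (z k) (z (k + 1)) ∈ AddSubgroup.zmultiples (2 * Real.pi) := by
  have h : ((∑ k, viewAngle x (z k) (z (k + 1)) : ℝ) : Real.Angle) = 0 := by
    rw [← Real.Angle.coe_coeHom, map_sum]
    simp only [Real.Angle.coe_coeHom, viewAngle]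
    have hx' : ∀ k, z k - x ≠ 0 := fun k => sub_ne_zero.2 (hx k)
    simp only [Complex.arg_div_coe_angle (hx' _) (hx' _), Finset.sum_sub_distrib]
    rw [sub_eq_zero]
    exact Equiv.sum_comp (Equiv.addRight (1 : Fin (m + 1)))
      (fun k => (Complex.arg (z k - x) : Real.Angle))
  exact (QuotientAddGroup.eq_zero_iff _).1 h

/-- The winding number of a closed polygon is constant on preconnected sets avoiding it. -/
lemma sum_viewAngle_eq_of_isPreconnected {m : ℕ} (z : Fin (m + 1) → ℂ) {s : Set ℂ}
    (hs : IsPreconnected s) (hz : ∀ x ∈ s, ∀ k, x ∉ segment ℝ (z k) (z (k + 1)))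
    {x y : ℂ} (hx : x ∈ s) (hy : y ∈ s) :
    ∑ k, viewAngle x (z k) (z (k + 1)) = ∑ k, viewAngle y (z k) (z (k + 1)) := by
  refine hs.constant_of_mapsTo (T := (AddSubgroup.zmultiples (2 * Real.pi) : Set ℝ))
    (hT := ⟨inferInstanceAs (DiscreteTopology (AddSubgroup.zmultiples (2 * Real.pi)))⟩)
    (f := fun x => ∑ k, viewAngle x (z k) (z (k + 1))) ?_ ?_ hx hy
  · intro x hx
    exact (tendsto_finsetSum _ fun k _ =>
      (continuousAt_viewAngle (hz x hx k)).tendsto).mono_left nhdsWithin_le_nhds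
  · intro x hx
    exact sum_viewAngle_mem_zmultiples z fun k hk =>
      hz x hx k (hk ▸ left_mem_segment ℝ _ _)

/-- The limit, along a direction `u` at a vertex `q` of a polygon, of the angle sum. -/
lemma arg_add_arg_add_eq_of_viewAngle {q a b u : ℂ} {g : ℂ → ℝ} {w : ℝ}
    (hg : ContinuousAt g q)
    (ha : (a - q) / (-u) ∈ Complex.slitPlane) (hb : -u / (b - q) ∈ Complex.slitPlane)
    (h : ∀ t ∈ Ioc (0 : ℝ) 1,
      viewAngle (q + t * u) q a + viewAngle (q + t * u) b q + g (q + t * u) = w) :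
    Complex.arg ((a - q) / (-u)) + Complex.arg (-u / (b - q)) + g q = w := by
  have hb0 : b - q ≠ 0 := by
    rintro h0
    simp [h0] at hb
  let F : ℝ → ℝ := fun t => Complex.arg ((a - (q + t * u)) / (-u)) +
    Complex.arg (-u / (b - (q + t * u))) + g (q + t * u)
  have hF : ContinuousAt F 0 := by
    refine (ContinuousAt.add ?_ ?_).add ?_
    · refine ContinuousAt.comp (g := Complex.arg) (Complex.continuousAt_arg (by simpa using ha)) ?_
      fun_prop
    · refine ContinuousAt.comp (g := Complex.arg) (Complex.continuousAt_arg (by simpa using hb)) ?_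
      fun_prop (disch := simpa using hb0)
    · refine ContinuousAt.comp (g := g) (by simpa using hg) ?_
      fun_prop
  have h1 : Filter.Tendsto F (nhdsWithin 0 (Ioi 0)) (nhds (F 0)) :=
    hF.tendsto.mono_left nhdsWithin_le_nhds
  have h2 : Filter.Tendsto F (nhdsWithin 0 (Ioi 0)) (nhds w) := by
    refine tendsto_const_nhds.congr' ?_
    filter_upwards [Ioc_mem_nhdsGT (zero_lt_one' ℝ)] with t ht
    rw [← h t ht]
    have e1 : viewAngle (q + t * u) q a = Complex.arg ((a - (q + t * u)) / (-u)) := by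
      rw [viewAngle, ← Complex.arg_real_mul ((a - (q + t * u)) / (-u)) (inv_pos.2 ht.1)]
      congr 1
      push_cast
      rw [sub_add_cancel_left, ← mul_neg, div_mul_eq_div_div, inv_mul_eq_div, div_right_comm]
    have e2 : viewAngle (q + t * u) b q = Complex.arg (-u / (b - (q + t * u))) := by
      rw [viewAngle, ← Complex.arg_real_mul (-u / (b - (q + t * u))) ht.1]
      congr 1
      rw [sub_add_cancel_left, ← mul_neg, mul_div_assoc]
    rw [e1, e2]
  have := tendsto_nhds_unique h1 h2
  simpa [F] using this

lemma Complex.arg_eq_of_coe_angle_eq {z : ℂ} {θ : ℝ} (h : (z.arg : Real.Angle) = θ)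
    (hθ : θ ∈ Ioc (-Real.pi) Real.pi) : z.arg = θ := by
  rw [← Complex.arg_coe_angle_toReal_eq_arg, h, Real.Angle.toReal_coe_eq_self_iff_mem_Ioc.2 hθ]

lemma arg_div_neg_of_arg_lt {u v : ℂ} (hu : u ≠ 0) (hv : v ≠ 0) (h : u.arg < v.arg) :
    (v / (-u)).arg = v.arg - u.arg - Real.pi := by
  have hu1 := Complex.neg_pi_lt_arg u
  have hv1 := Complex.arg_le_pi v
  refine Complex.arg_eq_of_coe_angle_eq ?_ ⟨by linarith, by linarith⟩
  rw [Complex.arg_div_coe_angle hv (neg_ne_zero.2 hu), Complex.arg_neg_coe_angle hu]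
  simp only [Real.Angle.coe_sub, Real.Angle.coe_add, sub_sub]

lemma arg_neg_div_of_arg_lt {u v : ℂ} (hu : u ≠ 0) (hv : v ≠ 0) (h : u.arg < v.arg) :
    (-u / v).arg = u.arg - v.arg + Real.pi := by
  have hu1 := Complex.neg_pi_lt_arg u
  have hv1 := Complex.arg_le_pi v
  refine Complex.arg_eq_of_coe_angle_eq ?_ ⟨by linarith, by linarith⟩
  rw [Complex.arg_div_coe_angle (neg_ne_zero.2 hu) hv, Complex.arg_neg_coe_angle hu]
  simp only [Real.Angle.coe_sub, Real.Angle.coe_add]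
  abel

lemma div_neg_mem_slitPlane {u v : ℂ} (hu : u ≠ 0) (hv : v ≠ 0) (h : u.arg ≠ v.arg) :
    v / (-u) ∈ Complex.slitPlane := by
  rw [Complex.mem_slitPlane_iff_arg]
  refine ⟨?_, div_ne_zero hv (neg_ne_zero.2 hu)⟩
  rcases h.lt_or_gt with h | h
  · rw [arg_div_neg_of_arg_lt hu hv h]
    linarith [Complex.neg_pi_lt_arg u, Complex.arg_le_pi v, Real.pi_pos]
  · rw [div_neg, ← neg_div, arg_neg_div_of_arg_lt hv hu h]
    linarith

lemma neg_div_mem_slitPlane {u v : ℂ} (hu : u ≠ 0) (hv : v ≠ 0) (h : u.arg ≠ v.arg) :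
    -u / v ∈ Complex.slitPlane := by
  rw [neg_div, ← div_neg]
  exact div_neg_mem_slitPlane hv hu h.symm

section Nonplanar

variable {ι : Type*} {O : ι → Set ℂ} {q : ι → ℂ} {P : Sym2 ι → ℂ}

lemma contact_injective (hP : ∀ z, ¬z.IsDiag → ∀ i, P z ∈ closure (O i) ↔ i ∈ z) {z w : Sym2 ι}
    (hz : ¬z.IsDiag) (hw : ¬w.IsDiag) (h : P z = P w) : z = w :=
  Sym2.ext fun i => by rw [← hP z hz, ← hP w hw, h]

lemma contact_notMem (ho : ∀ i, IsOpen (O i)) (hd : Pairwise fun i j => Disjoint (O i) (O j))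
    (hP : ∀ z, ¬z.IsDiag → ∀ i, P z ∈ closure (O i) ↔ i ∈ z) {i j : ι} (hij : i ≠ j) (k : ι) :
    P s(i, j) ∉ O k := by
  have hz : ¬(s(i, j)).IsDiag := by simpa using hij
  intro h
  by_cases hki : k = i
  · exact ((hd (hki ▸ hij)).closure_right (ho k)).le_bot
      ⟨h, (hP _ hz j).2 (Sym2.mem_mk_right i j)⟩
  · exact ((hd hki).closure_right (ho k)).le_bot ⟨h, (hP _ hz i).2 (Sym2.mem_mk_left i j)⟩

lemma mem_or_eq_of_mem_segment_contact (ho : ∀ i, IsOpen (O i)) (hc : ∀ i, Convex ℝ (O i))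
    (hq : ∀ i, q i ∈ O i) (hP : ∀ z, ¬z.IsDiag → ∀ i, P z ∈ closure (O i) ↔ i ∈ z) {i j : ι}
    (hij : i ≠ j) {x : ℂ} (hx : x ∈ segment ℝ (q i) (P s(i, j))) :
    x ∈ O i ∨ x = P s(i, j) := by
  have hz : ¬(s(i, j)).IsDiag := by simpa using hij
  rw [← insert_endpoints_openSegment] at hx
  rcases hx with rfl | rfl | hx
  · exact Or.inl (hq i)
  · exact Or.inr rfl
  · left
    have := (hc i).openSegment_interior_closure_subset_interior ((ho i).interior_eq.symm ▸ hq i)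
      ((hP _ hz i).2 (Sym2.mem_mk_left i j)) hx
    rwa [(ho i).interior_eq] at this

lemma contact_sub_ne_smul (ho : ∀ i, IsOpen (O i)) (hc : ∀ i, Convex ℝ (O i))
    (hd : Pairwise fun i j => Disjoint (O i) (O j)) (hq : ∀ i, q i ∈ O i)
    (hP : ∀ z, ¬z.IsDiag → ∀ i, P z ∈ closure (O i) ↔ i ∈ z) {i j k : ι}
    (hij : i ≠ j) (hik : i ≠ k) (hjk : j ≠ k) {r : ℝ} (hr : 0 < r) :
    P s(i, j) - q i ≠ r • (P s(i, k) - q i) := by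
  wlog hr1 : r ≤ 1 generalizing j k r
  · intro h
    refine this hik hij hjk.symm (inv_pos.2 hr) (inv_le_one_of_one_le₀ (not_le.1 hr1).le) ?_
    rw [h, inv_smul_smul₀ hr.ne']
  intro h
  have hx : P s(i, j) ∈ segment ℝ (q i) (P s(i, k)) := by
    rw [segment_eq_image']
    exact ⟨r, ⟨hr.le, hr1⟩, by simp only [← h]; abel⟩
  rcases mem_or_eq_of_mem_segment_contact ho hc hq hP hik hx with h1 | h1
  · exact contact_notMem ho hd hP hij i h1
  · have := contact_injective hP (by simpa using hij) (by simpa using hik) h1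
    simp [hjk, hij.symm, hik] at this

lemma segment_contact_inter (ho : ∀ i, IsOpen (O i)) (hc : ∀ i, Convex ℝ (O i))
    (hd : Pairwise fun i j => Disjoint (O i) (O j)) (hq : ∀ i, q i ∈ O i)
    (hP : ∀ z, ¬z.IsDiag → ∀ i, P z ∈ closure (O i) ↔ i ∈ z) {i j k l : ι}
    (hij : i ≠ j) (hkl : k ≠ l) (hne : s(i, j) ≠ s(k, l)) {x : ℂ}
    (hx : x ∈ segment ℝ (q i) (P s(i, j))) (hx' : x ∈ segment ℝ (q k) (P s(k, l))) :
    i = k ∧ x = q i := by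
  by_cases hik : i = k
  · subst hik
    refine ⟨rfl, ?_⟩
    have hjl : j ≠ l := fun h => hne (h ▸ rfl)
    by_contra hxq
    rw [segment_eq_image'] at hx hx'
    obtain ⟨s, hs, rfl⟩ := hx
    obtain ⟨t, ht, hst⟩ := hx'
    simp only [add_right_inj] at hst
    have hs0 : s ≠ 0 := by
      rintro rfl
      simp at hxq
    have ht0 : t ≠ 0 := by
      rintro rfl
      simp [← hst] at hxq
    refine contact_sub_ne_smul ho hc hd hq hP hij hkl hjl
      (div_pos (ht.1.lt_of_ne' ht0) (hs.1.lt_of_ne' hs0)) ?_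
    rw [div_eq_inv_mul, mul_smul, hst, inv_smul_smul₀ hs0]
  · exfalso
    rcases mem_or_eq_of_mem_segment_contact ho hc hq hP hij hx with h | h <;>
    rcases mem_or_eq_of_mem_segment_contact ho hc hq hP hkl hx' with h' | h'
    · exact (hd hik).le_bot ⟨h, h'⟩
    · exact contact_notMem ho hd hP hkl i (h' ▸ h)
    · exact contact_notMem ho hd hP hij k (h ▸ h')
    · exact hne (contact_injective hP (by simpa using hij) (by simpa using hkl) (h.symm.trans h'))

lemma arg_contact_injective (ho : ∀ i, IsOpen (O i)) (hc : ∀ i, Convex ℝ (O i))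
    (hd : Pairwise fun i j => Disjoint (O i) (O j)) (hq : ∀ i, q i ∈ O i)
    (hP : ∀ z, ¬z.IsDiag → ∀ i, P z ∈ closure (O i) ↔ i ∈ z) {i j k : ι}
    (hij : i ≠ j) (hik : i ≠ k) (hjk : j ≠ k) :
    (P s(i, j) - q i).arg ≠ (P s(i, k) - q i).arg := by
  have hne : ∀ {j}, i ≠ j → P s(i, j) - q i ≠ 0 := fun {j} hij h =>
    contact_notMem ho hd hP hij i (sub_eq_zero.1 h ▸ hq i)
  intro h
  rw [Complex.arg_eq_arg_iff (hne hij) (hne hik)] at h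
  refine contact_sub_ne_smul ho hc hd hq hP hik hij hjk.symm
    (div_pos (norm_pos_iff.2 (hne hik)) (norm_pos_iff.2 (hne hij))) ?_
  rw [Complex.real_smul]
  push_cast
  exact h.symm

/-- At a vertex `v`, the two arcs cut off by the directions of `a` and `b` cannot contain the
directions of `c` and `d` respectively: the cycle through `v`, `a`, `b` would separate `c` from
`d`. -/
lemma not_arg_contact_alternate (ho : ∀ i, IsOpen (O i)) (hc : ∀ i, Convex ℝ (O i))
    (hd : Pairwise fun i j => Disjoint (O i) (O j)) (hq : ∀ i, q i ∈ O i)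
    (hP : ∀ z, ¬z.IsDiag → ∀ i, P z ∈ closure (O i) ↔ i ∈ z) {v a b c d : ι}
    (hva : v ≠ a) (hvb : v ≠ b) (hvc : v ≠ c) (hvd : v ≠ d)
    (hac : (P s(v, a) - q v).arg < (P s(v, c) - q v).arg)
    (hcb : (P s(v, c) - q v).arg < (P s(v, b) - q v).arg)
    (hbd : (P s(v, b) - q v).arg < (P s(v, d) - q v).arg) : False := by
  have hab : a ≠ b := by rintro rfl; linarith
  have hca : c ≠ a := by rintro rfl; linarith
  have hcb' : c ≠ b := by rintro rfl; linarith
  have hda : d ≠ a := by rintro rfl; linarith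
  have hdb : d ≠ b := by rintro rfl; linarith
  have hcd : c ≠ d := by rintro rfl; linarith
  have hne : ∀ {j}, v ≠ j → P s(v, j) - q v ≠ 0 := fun {j} hj h =>
    contact_notMem ho hd hP hj v (sub_eq_zero.1 h ▸ hq v)
  let z : Fin 6 → ℂ := ![q v, P s(v, a), q a, P s(a, b), q b, P s(v, b)]
  have hz : ∀ k, ∃ i j, i ≠ j ∧ (i = v ∨ i = a ∨ i = b) ∧ (j = v ∨ j = a ∨ j = b) ∧
      segment ℝ (z k) (z (k + 1)) = segment ℝ (q i) (P s(i, j)) := by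
    intro k
    fin_cases k
    · exact ⟨v, a, hva, by simp, by simp, rfl⟩
    · exact ⟨a, v, hva.symm, by simp, by simp, by rw [segment_symm, Sym2.eq_swap]; rfl⟩
    · exact ⟨a, b, hab, by simp, by simp, rfl⟩
    · exact ⟨b, a, hab.symm, by simp, by simp, by rw [segment_symm, Sym2.eq_swap]; rfl⟩
    · exact ⟨b, v, hvb.symm, by simp, by simp, by rw [Sym2.eq_swap]; rfl⟩
    · exact ⟨v, b, hvb, by simp, by simp, by rw [segment_symm]; rfl⟩
  have havoid : ∀ {i j : ι} {x : ℂ}, i ≠ j → (i = c ∨ i = d ∨ j = c ∨ j = d) →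
      (x = q i → i = c ∨ i = d) → x ∈ segment ℝ (q i) (P s(i, j)) →
      ∀ k, x ∉ segment ℝ (z k) (z (k + 1)) := by
    intro i j x hij h1 h2 hx k hk
    obtain ⟨k', l, hkl, hk', hl, he⟩ := hz k
    rw [he] at hk
    have := segment_contact_inter ho hc hd hq hP hij hkl (by
      rw [Ne, Sym2.eq_iff]
      grind) hx hk
    grind
  let F : ℂ → ℝ := fun x => ∑ k, viewAngle x (z k) (z (k + 1))
  have hseg : ∀ {i j : ι}, i ≠ j → (i = c ∨ i = d) → F (q i) = F (P s(i, j)) := by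
    intro i j hij hi
    exact sum_viewAngle_eq_of_isPreconnected z (convex_segment _ _).isPreconnected
      (fun x hx => havoid hij (by tauto) (fun _ => hi) hx)
      (left_mem_segment ℝ _ _) (right_mem_segment ℝ _ _)
  have hray : ∀ {j : ι}, v ≠ j → (j = c ∨ j = d) → ∀ t ∈ Ioc (0 : ℝ) 1,
      F (q v + t * (P s(v, j) - q v)) = F (P s(v, j)) := by
    intro j hj hjc t ht
    have hpre : IsPreconnected ((fun t : ℝ => q v + t * (P s(v, j) - q v)) '' Ioc 0 1) :=
      isPreconnected_Ioc.image _ (by fun_prop)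
    refine sum_viewAngle_eq_of_isPreconnected z hpre ?_ ⟨t, ht, rfl⟩
      ⟨1, by simp, by simp⟩
    rintro _ ⟨s, hs, rfl⟩
    refine havoid hj (by tauto) (fun h => ?_) ?_
    · have : (s : ℂ) * (P s(v, j) - q v) = 0 := by simpa using h
      rcases mul_eq_zero.1 this with h0 | h0
      · exact absurd (Complex.ofReal_eq_zero.1 h0) hs.1.ne'
      · exact absurd h0 (hne hj)
    · rw [segment_eq_image']
      exact ⟨s, ⟨hs.1.le, hs.2⟩, by simp⟩
  have hloop : F (P s(v, c)) = F (P s(v, d)) := by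
    rw [Sym2.eq_swap (a := v) (b := c), Sym2.eq_swap (a := v) (b := d),
      ← hseg hvc.symm (Or.inl rfl), ← hseg hvd.symm (Or.inr rfl), hseg hcd (Or.inl rfl),
      hseg hcd.symm (Or.inr rfl), Sym2.eq_swap]
  let g : ℂ → ℝ := fun x => viewAngle x (P s(v, a)) (q a) + viewAngle x (q a) (P s(a, b)) +
    viewAngle x (P s(a, b)) (q b) + viewAngle x (q b) (P s(v, b))
  have hFg : ∀ x, viewAngle x (q v) (P s(v, a)) + viewAngle x (P s(v, b)) (q v) + g x = F x := by
    intro x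
    simp only [F, g, Fin.sum_univ_six]
    simp only [z, Fin.isValue]
    change _ = viewAngle x (q v) (P s(v, a)) + viewAngle x (P s(v, a)) (q a) +
      viewAngle x (q a) (P s(a, b)) + viewAngle x (P s(a, b)) (q b) +
      viewAngle x (q b) (P s(v, b)) + viewAngle x (P s(v, b)) (q v)
    ring
  have hg : ContinuousAt g (q v) := by
    have hnot : ∀ {i j : ι}, i ≠ j → i ≠ v → q v ∉ segment ℝ (q i) (P s(i, j)) := by
      intro i j hij hiv h
      rcases mem_or_eq_of_mem_segment_contact ho hc hq hP hij h with h | h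
      · exact (hd hiv).le_bot ⟨h, hq v⟩
      · exact contact_notMem ho hd hP hij v (h ▸ hq v)
    refine ContinuousAt.add (ContinuousAt.add (ContinuousAt.add ?_ ?_) ?_) ?_ <;>
      apply continuousAt_viewAngle
    · rw [segment_symm, Sym2.eq_swap]
      exact hnot hva.symm hva.symm
    · exact hnot hab hva.symm
    · rw [segment_symm, Sym2.eq_swap]
      exact hnot hab.symm hvb.symm
    · rw [Sym2.eq_swap]
      exact hnot hvb.symm hvb.symm
  have key : ∀ {j : ι}, v ≠ j → (j = c ∨ j = d) → j ≠ a → j ≠ b →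
      ((P s(v, a) - q v) / (-(P s(v, j) - q v))).arg +
        (-(P s(v, j) - q v) / (P s(v, b) - q v)).arg + g (q v) = F (P s(v, j)) := by
    intro j hj hjc hja hjb
    refine arg_add_arg_add_eq_of_viewAngle hg
      (div_neg_mem_slitPlane (hne hj) (hne hva)
        (arg_contact_injective ho hc hd hq hP hj hva hja))
      (neg_div_mem_slitPlane (hne hj) (hne hvb)
        (arg_contact_injective ho hc hd hq hP hj hvb hjb)) ?_
    intro t ht
    rw [hFg, hray hj hjc t ht]
  have kc := key hvc (Or.inl rfl) hca hcb'
  have kd := key hvd (Or.inr rfl) hda hdb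
  rw [div_neg, ← neg_div, arg_neg_div_of_arg_lt (hne hva) (hne hvc) hac,
    arg_neg_div_of_arg_lt (hne hvc) (hne hvb) hcb] at kc
  rw [div_neg, ← neg_div, arg_neg_div_of_arg_lt (hne hva) (hne hvd) (by linarith),
    neg_div, ← div_neg, arg_div_neg_of_arg_lt (hne hvb) (hne hvd) hbd] at kd
  linarith [Real.pi_pos]

/-- There are no five pairwise disjoint open convex sets in the plane such that any two of them
share a boundary point which does not adhere to any of the others. -/
theorem not_five_pairwise_contacts {O : Fin 5 → Set ℂ} (ho : ∀ i, IsOpen (O i))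
    (hc : ∀ i, Convex ℝ (O i)) (hne : ∀ i, (O i).Nonempty)
    (hd : Pairwise fun i j => Disjoint (O i) (O j)) :
    ¬∀ z : Sym2 (Fin 5), ¬z.IsDiag → ∃ p, ∀ i, p ∈ closure (O i) ↔ i ∈ z := by
  intro h
  choose q hq using hne
  have h' : ∀ z : Sym2 (Fin 5), ∃ p, ¬z.IsDiag → ∀ i, p ∈ closure (O i) ↔ i ∈ z := by
    intro z
    by_cases hz : z.IsDiag
    · exact ⟨0, fun h => absurd hz h⟩
    · exact (h z hz).imp fun p hp _ => hp
  choose P hP using h'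
  let e : Fin 4 → Fin 5 := Fin.castSucc
  have he : ∀ i, Fin.last 4 ≠ e i := fun i => (Fin.castSucc_lt_last i).ne'
  let θ : Fin 4 → ℝ := fun i => (P s(Fin.last 4, e i) - q (Fin.last 4)).arg
  have hθ : Function.Injective θ := by
    intro i j hij
    by_contra hne
    exact arg_contact_injective ho hc hd hq hP (he i) (he j)
      (fun h => hne (Fin.castSucc_injective 4 h)) hij
  have hmono : StrictMono (θ ∘ Tuple.sort θ) :=
    (Tuple.monotone_sort θ).strictMono_of_injective (hθ.comp (Tuple.sort θ).injective)
  exact not_arg_contact_alternate ho hc hd hq hP (he _) (he _) (he _) (he _)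
    (hmono (show (0 : Fin 4) < 1 by decide)) (hmono (show (1 : Fin 4) < 2 by decide))
    (hmono (show (2 : Fin 4) < 3 by decide))

end Nonplanar

/-- Two sets touch at `p` if they have disjoint nonempty interiors, both adhere to `p`, and together
they fill a neighbourhood of `p`, up to closure. -/
structure TouchesAt {E : Type*} [TopologicalSpace E] (K L : Set E) (p : E) : Prop where
  mem_left : p ∈ closure K
  mem_right : p ∈ closure L
  union_mem_nhds : closure K ∪ closure L ∈ nhds p
  left_nonempty : (interior K).Nonempty
  right_nonempty : (interior L).Nonempty
  disjoint : Disjoint (interior K) (interior L)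

lemma TouchesAt.symm {E : Type*} [TopologicalSpace E] {K L : Set E} {p : E} (h : TouchesAt K L p) :
    TouchesAt L K p :=
  ⟨h.mem_right, h.mem_left, union_comm _ _ ▸ h.union_mem_nhds, h.right_nonempty, h.left_nonempty,
    h.disjoint.symm⟩

section Touching

variable {E : Type*} [NormedAddCommGroup E] [NormedSpace ℝ E]

lemma Convex.interior_closure_nonempty_iff [FiniteDimensional ℝ E] {K : Set E} (hK : Convex ℝ K) :
    (interior (closure K)).Nonempty ↔ (interior K).Nonempty := by
  refine ⟨fun h => ?_, fun h => h.mono (interior_mono subset_closure)⟩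
  rw [hK.interior_nonempty_iff_affineSpan_eq_top]
  rw [hK.closure.interior_nonempty_iff_affineSpan_eq_top] at h
  have : affineSpan ℝ (closure K) ≤ affineSpan ℝ K :=
    affineSpan_le.2 (closure_minimal (subset_affineSpan ℝ K)
      (affineSpan ℝ K).closed_of_finiteDimensional)
  exact top_le_iff.1 (h ▸ this)

lemma TouchesAt.mem_closure_interior_iff {ι : Type*} {K : ι → Set E} (hK : ∀ i, Convex ℝ (K i))
    (hne : ∀ i, (interior (K i)).Nonempty)
    (hd : Pairwise fun i j => Disjoint (interior (K i)) (interior (K j))) {i j : ι} {p : E}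
    (h : TouchesAt (K i) (K j) p) (k : ι) :
    p ∈ closure (interior (K k)) ↔ k = i ∨ k = j := by
  have hc : ∀ i, closure (interior (K i)) = closure (K i) := fun i =>
    (hK i).closure_interior_eq_closure_of_nonempty_interior (hne i)
  constructor
  · intro hp
    by_contra! hk
    obtain ⟨x, hx, hxk⟩ := mem_closure_iff_nhds.1 hp _ h.union_mem_nhds
    rw [← hc i, ← hc j, ← closure_union] at hx
    exact (((hd hk.1).union_right (hd hk.2)).closure_right isOpen_interior).le_bot ⟨hxk, hx⟩
  · rintro (rfl | rfl)
    · rw [hc]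
      exact h.mem_left
    · rw [hc]
      exact h.mem_right

/-- If the level set `{f = c}` avoids the convex set `K` near `p` and `K` adheres to `p` from the
side `{c < f}`, then `K` lies on the side `{c ≤ f}`. -/
lemma Convex.le_of_mem_closure_inter {K : Set E} (hK : Convex ℝ K) {f : E →L[ℝ] ℝ} {p : E}
    (hne : ∀ᶠ x in nhds p, x ∈ K → f x ≠ f p) (hp : p ∈ closure (K ∩ {x | f p < f x})) :
    ∀ y ∈ K, f p ≤ f y := by
  intro y hy
  by_contra! hlt
  let g : E → E := fun x => x + ((f x - f p) / (f x - f y)) • (y - x)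
  have hg : ContinuousAt g p := by
    have : f p - f y ≠ 0 := (sub_pos.2 hlt).ne'
    fun_prop (disch := assumption)
  have hgp : g p = p := by simp [g]
  have hev : ∀ᶠ x in nhds p, g x ∈ K → f (g x) ≠ f p :=
    hg.eventually (by rwa [hgp])
  obtain ⟨x, hx, hxK, hxp⟩ := mem_closure_iff_nhds.1 hp _ hev
  simp only [mem_ofPred_eq] at hxp
  have hpos : 0 < f x - f y := by linarith
  refine hx (hK.add_smul_sub_mem hxK hy ⟨div_nonneg (by linarith) hpos.le,
    (div_le_one hpos).2 (by linarith)⟩) ?_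
  simp only [g, map_add, map_smul, map_sub, smul_eq_mul]
  field_simp
  ring

/-- A convex set containing a neighbourhood of `p` in the level set of `f` through `p`, and a point
on the positive side, contains a half-neighbourhood of `p`. -/
lemma Convex.eventually_mem_of_le {C : Set E} (hC : Convex ℝ C) {f : E →L[ℝ] ℝ} {p y : E}
    (hp : ∀ᶠ x in nhds p, f x = f p → x ∈ C) (hy : y ∈ C) (hfy : f p < f y) :
    ∀ᶠ x in nhds p, f p ≤ f x → x ∈ C := by
  let s : E → ℝ := fun x => (f x - f p) / (f y - f p)
  have hs : ContinuousAt s p := by fun_prop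
  have hs0 : s p = 0 := by simp [s]
  let g : E → E := fun x => (1 - s x)⁻¹ • (x - s x • y)
  have hg : ContinuousAt g p := by
    have : 1 - s p ≠ 0 := by simp [hs0]
    fun_prop (disch := assumption)
  have hgp : g p = p := by simp [g, hs0]
  have hev : ∀ᶠ x in nhds p, f (g x) = f p → g x ∈ C := hg.eventually (by rwa [hgp])
  have hlt : ∀ᶠ x in nhds p, s x < 1 := hs.eventually (gt_mem_nhds (by simp [hs0]))
  filter_upwards [hev, hlt] with x hx hx1 hfx
  have h1 : 0 < 1 - s x := sub_pos.2 hx1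
  have hpos : 0 < f y - f p := sub_pos.2 hfy
  have hsx : s x * (f y - f p) = f x - f p := div_mul_cancel₀ _ hpos.ne'
  have hgx : g x ∈ C := by
    refine hx ?_
    simp only [g, map_smul, map_sub, smul_eq_mul]
    rw [inv_mul_eq_iff_eq_mul₀ h1.ne']
    linear_combination -hsx
  have hxe : s x • y + (1 - s x) • g x = x := by
    simp only [g]
    rw [smul_inv_smul₀ h1.ne']
    abel
  rw [← hxe]
  exact hC hy hgx (div_nonneg (sub_nonneg.2 hfx) hpos.le) h1.le (by ring)

lemma mem_closure_setOf_lt_apply {f : E →L[ℝ] ℝ} (hf : f ≠ 0) (p : E) :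
    p ∈ closure {x | f p < f x} := by
  obtain ⟨v, hv⟩ : ∃ v, 0 < f v := by
    obtain ⟨v, hv⟩ := DFunLike.ne_iff.1 hf
    rcases lt_or_gt_of_ne hv with h | h
    · exact ⟨-v, by simpa using h⟩
    · exact ⟨v, h⟩
  have ht : Filter.Tendsto (fun t : ℝ => p + t • v) (nhdsWithin 0 (Ioi 0)) (nhds p) := by
    have : ContinuousAt (fun t : ℝ => p + t • v) 0 := by fun_prop
    simpa using this.tendsto.mono_left nhdsWithin_le_nhds
  refine mem_closure_of_tendsto ht ?_
  filter_upwards [self_mem_nhdsWithin] with t ht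
  simpa using mul_pos ht hv

/-- Finitely many convex sets covering one side of the level set of `f` through `p`, and avoiding
the level set near `p`: one of them lies on that side and fills it near `p`, up to closure,
provided the closure of each set that adheres to `p` is a neighbourhood of `p` in the level set. -/
lemma exists_convex_eventually_mem_closure {ι : Type*} [Finite ι] {K : ι → Set E}
    (hK : ∀ i, Convex ℝ (K i)) {f : E →L[ℝ] ℝ} (hf : f ≠ 0) {p : E}
    (hcov : ∀ᶠ x in nhds p, (∃ i, x ∈ K i) ↔ f x ≠ f p)
    (hp : ∀ i, p ∈ closure (K i) → ∀ᶠ x in nhds p, f x = f p → x ∈ closure (K i)) :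
    ∃ i, (∀ x ∈ closure (K i), f p ≤ f x) ∧
      ∀ᶠ x in nhds p, f p ≤ f x → x ∈ closure (K i) := by
  have hside := mem_closure_setOf_lt_apply hf p
  have hmem : p ∈ closure (⋃ i, K i ∩ {x | f p < f x}) := by
    rw [mem_closure_iff_nhds] at hside ⊢
    intro t ht
    obtain ⟨x, ⟨hxt, hx⟩, hxp⟩ := hside _ (Filter.inter_mem ht hcov)
    obtain ⟨i, hi⟩ := hx.2 (ne_of_gt hxp)
    exact ⟨x, hxt, mem_iUnion.2 ⟨i, hi, hxp⟩⟩
  rw [closure_iUnion_of_finite, mem_iUnion] at hmem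
  obtain ⟨i, hi⟩ := hmem
  have hpi : p ∈ closure (K i) := closure_mono inter_subset_left hi
  obtain ⟨y, hy, hfy⟩ := closure_nonempty_iff.1 ⟨p, hi⟩
  refine ⟨i, fun x hx => ?_, (hK i).closure.eventually_mem_of_le (hp i hpi) (subset_closure hy) hfy⟩
  have hle := (hK i).le_of_mem_closure_inter
    (hcov.mono fun x hx hxi => hx.1 ⟨i, hxi⟩) hi
  exact closure_minimal hle (isClosed_le continuous_const f.continuous) hx

end Touching

lemma AffineSubspace.exists_mem_iff_of_finrank_direction_eq_one
    {H : AffineSubspace ℝ (EuclideanSpace ℝ (Fin 2))} (hH : finrank ℝ H.direction = 1) :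
    ∃ f : EuclideanSpace ℝ (Fin 2) →L[ℝ] ℝ, f ≠ 0 ∧ ∀ p ∈ H, ∀ x, x ∈ H ↔ f x = f p := by
  have hlt : H.direction < ⊤ := by
    refine lt_top_iff_ne_top.2 fun h => ?_
    rw [h, finrank_top, finrank_euclideanSpace_fin] at hH
    omega
  obtain ⟨f, hf, hle⟩ := Submodule.exists_le_ker_of_lt_top _ hlt
  have hker : H.direction = LinearMap.ker f := by
    refine Submodule.eq_of_le_of_finrank_eq hle ?_
    have := Module.Dual.finrank_ker_add_one_of_ne_zero hf
    rw [finrank_euclideanSpace_fin] at this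
    omega
  refine ⟨f.toContinuousLinearMap, fun h => hf ?_, fun p hp x => ?_⟩
  · ext x
    exact DFunLike.congr_fun h x
  · rw [← H.vsub_right_mem_direction_iff_mem hp x, hker, LinearMap.mem_ker, vsub_eq_sub, map_sub,
      sub_eq_zero]
    rfl

/-- A generic point of a line near a given one is interior, relative to the line, to every one of
finitely many closed sets that contains it. -/
lemma AffineSubspace.exists_mem_forall_eventually_mem {E ι : Type*} [NormedAddCommGroup E]
    [InnerProductSpace ℝ E] [Finite ι] {H : AffineSubspace ℝ E} (hH : finrank ℝ H.direction = 1)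
    {C : ι → Set E} (hC : ∀ i, IsClosed (C i)) {p : E} (hp : p ∈ H) {U : Set E}
    (hU : U ∈ nhds p) :
    ∃ p' ∈ H, p' ∈ interior U ∧ ∀ i, p' ∈ C i → ∀ᶠ x in nhds p', x ∈ H → x ∈ C i := by
  obtain ⟨v, hv0, hv⟩ := finrank_eq_one_iff'.1 hH
  have hv0' : (v : E) ≠ 0 := by simpa using hv0
  let l : ℝ → E := fun t => p + t • (v : E)
  have hl : Continuous l := by fun_prop
  have hlH : ∀ t, l t ∈ H := fun t => by
    rw [← H.vsub_right_mem_direction_iff_mem hp]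
    simpa [l] using H.direction.smul_mem t v.2
  have hdense : Dense (⋂ i, (frontier (l ⁻¹' C i))ᶜ) := by
    refine dense_iInter_of_isOpen (fun i => isClosed_frontier.isOpen_compl) fun i => ?_
    rw [← interior_eq_empty_iff_dense_compl]
    exact interior_frontier ((hC i).preimage hl)
  have hUl : l ⁻¹' interior U ∈ nhds 0 :=
    hl.continuousAt.preimage_mem_nhds (isOpen_interior.mem_nhds (by
      simpa [l] using mem_interior_iff_mem_nhds.2 hU))
  obtain ⟨t, ht, htU⟩ := hdense.inter_nhds_nonempty hUl
  refine ⟨l t, hlH t, htU, fun i hi => ?_⟩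
  have hti : l ⁻¹' C i ∈ nhds t := by
    rw [← mem_interior_iff_mem_nhds]
    by_contra hni
    exact mem_iInter.1 ht i ⟨subset_closure hi, hni⟩
  let τ : E → ℝ := fun x => inner ℝ (v : E) (x - p) / inner ℝ (v : E) (v : E)
  have hτ : Continuous τ := by fun_prop
  have hτl : ∀ t, τ (l t) = t := fun t => by
    simp only [τ, l, add_sub_cancel_left, inner_smul_right]
    exact mul_div_cancel_right₀ _ (inner_self_ne_zero.2 hv0')
  have hev : ∀ᶠ x in nhds (l t), τ x ∈ l ⁻¹' C i :=
    hτ.continuousAt.eventually (by rwa [hτl])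
  filter_upwards [hev] with x hx hxH
  obtain ⟨s, hs⟩ := hv ⟨x - p, H.vsub_mem_direction hxH hp⟩
  have hxs : x = l s := by
    have := congrArg Subtype.val hs
    simp only [Submodule.coe_smul] at this
    simp [l, this]
  rw [hxs, mem_preimage, hτl] at hx
  rwa [hxs]

lemma exists_touchesAt_of_isOrdinaryFlat {ι : Type*} [Finite ι]
    {K : ι → Set (EuclideanSpace ℝ (Fin 2))} (hK : ∀ i, Convex ℝ (K i))
    {H : AffineSubspace ℝ (EuclideanSpace ℝ (Fin 2))} (hH : IsOrdinaryFlat (⋃ i, K i)ᶜ 1 H) :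
    ∃ i j p, TouchesAt (K i) (K j) p ∧ p ∈ H ∧
      (∀ x, x ∈ closure (K i) → x ∈ closure (K j) → x ∈ H) ∧
      ∀ᶠ x in nhds p, x ∈ H → x ∈ closure (K i) ∧ x ∈ closure (K j) := by
  obtain ⟨hH1, p₀, hp₀, -, U, hU, hpU, hSU⟩ := hH
  obtain ⟨f, hf, hfH⟩ := H.exists_mem_iff_of_finrank_direction_eq_one hH1
  have hp₀H : p₀ ∈ H := (hSU.subset ⟨hp₀, hpU⟩).1
  obtain ⟨p, hpH, hpU, hloc⟩ := H.exists_mem_forall_eventually_mem hH1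
    (fun i => isClosed_closure (s := K i)) hp₀H (hU.mem_nhds hpU)
  simp only [hfH p hpH] at hloc ⊢
  have hcov : ∀ᶠ x in nhds p, (∃ i, x ∈ K i) ↔ f x ≠ f p := by
    filter_upwards [isOpen_interior.mem_nhds hpU] with x hx
    have hxU := interior_subset hx
    have := Set.ext_iff.1 hSU x
    simp only [mem_inter_iff, mem_compl_iff, mem_iUnion, hxU, and_true, SetLike.mem_coe,
      hfH p hpH] at this
    rw [Ne, ← this, not_not]
  obtain ⟨i, hi, hi'⟩ := exists_convex_eventually_mem_closure hK hf hcov hloc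
  obtain ⟨j, hj, hj'⟩ := exists_convex_eventually_mem_closure hK (neg_ne_zero.2 hf)
    (by simpa using hcov) (by simpa using hloc)
  simp only [neg_apply, neg_le_neg_iff] at hj hj'
  have hinterior : ∀ {C : Set (EuclideanSpace ℝ (Fin 2))} {g : EuclideanSpace ℝ (Fin 2) →L[ℝ] ℝ},
      g ≠ 0 → Convex ℝ C → (∀ᶠ x in nhds p, g p ≤ g x → x ∈ closure C) →
      (interior C).Nonempty := by
    intro C g hg hC h
    rw [← hC.interior_closure_nonempty_iff]
    obtain ⟨x, hx, hpx⟩ :=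
      mem_closure_iff_nhds.1 (mem_closure_setOf_lt_apply hg p) _ h.eventually_nhds
    refine ⟨x, mem_interior_iff_mem_nhds.2 ?_⟩
    filter_upwards [hx, (isOpen_lt continuous_const g.continuous).mem_nhds hpx] with y hy hy'
    exact hy (le_of_lt hy')
  have hdisj : Disjoint (interior (K i)) (interior (K j)) := by
    rw [Set.disjoint_iff_inter_eq_empty, ← interior_inter]
    by_contra hne
    obtain ⟨x, hx⟩ := nonempty_iff_ne_empty.2 hne
    have hmem : ∀ y ∈ interior (K i ∩ K j), f y = f p := fun y hy =>
      le_antisymm (hj y (subset_closure (interior_subset hy).2))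
        (hi y (subset_closure (interior_subset hy).1))
    obtain ⟨y, hy, hxy⟩ := mem_closure_iff_nhds.1 (mem_closure_setOf_lt_apply hf x) _
      (isOpen_interior.mem_nhds hx)
    exact hxy.ne ((hmem x hx).trans (hmem y hy).symm)
  refine ⟨i, j, p, ⟨hi'.self_of_nhds le_rfl, hj'.self_of_nhds le_rfl, ?_, hinterior hf (hK i) hi',
    hinterior (neg_ne_zero.2 hf) (hK j) (by simpa using hj'), hdisj⟩, rfl,
    fun x hxi hxj => le_antisymm (hj x hxj) (hi x hxi), ?_⟩
  · filter_upwards [hi', hj'] with x hx hx'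
    exact (le_total (f p) (f x)).imp hx hx'
  · filter_upwards [hi', hj'] with x hx hx' h
    exact ⟨hx h.ge, hx' h.le⟩

lemma AffineSubspace.eq_of_eventually_mem {E : Type*} [NormedAddCommGroup E] [NormedSpace ℝ E]
    {H H' : AffineSubspace ℝ E} [FiniteDimensional ℝ H'.direction]
    (hd : finrank ℝ H.direction = finrank ℝ H'.direction) {p : E} (hp : p ∈ H)
    (h : ∀ᶠ x in nhds p, x ∈ H → x ∈ H') : H = H' := by
  have hp' : p ∈ H' := h.self_of_nhds hp
  refine AffineSubspace.ext_of_direction_eq (Submodule.eq_of_le_of_finrank_eq (fun v hv => ?_) hd)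
    ⟨p, hp, hp'⟩
  have hc : ContinuousAt (fun t : ℝ => p + t • v) 0 := by fun_prop
  have hev : ∀ᶠ t : ℝ in nhdsWithin 0 (Ioi 0), p + t • v ∈ H → p + t • v ∈ H' :=
    (hc.eventually (by simpa using h)).filter_mono nhdsWithin_le_nhds
  obtain ⟨t, ht, ht0⟩ := (hev.and self_mem_nhdsWithin).exists
  have hmem := ht ((H.vsub_right_mem_direction_iff_mem hp _).1 (by
    simpa using H.direction.smul_mem t hv))
  have := (H'.vsub_right_mem_direction_iff_mem hp' _).2 hmem
  rw [vsub_eq_sub, add_sub_cancel_left] at this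
  exact (H'.direction.smul_mem_iff (ne_of_gt ht0)).1 this

/-- The graph in which two indices are adjacent when the corresponding sets touch at some point. -/
def touchingGraph {ι E : Type*} [TopologicalSpace E] (K : ι → Set E) : SimpleGraph ι where
  Adj i j := ∃ p, TouchesAt (K i) (K j) p
  symm := ⟨fun _ _ ⟨p, h⟩ => ⟨p, h.symm⟩⟩
  loopless := ⟨fun _ ⟨_, h⟩ => h.left_nonempty.ne_empty (disjoint_self.1 h.disjoint)⟩

lemma touchingGraph_cliqueFree {ι : Type*} {K : ι → Set (EuclideanSpace ℝ (Fin 2))}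
    (hK : ∀ i, Convex ℝ (K i)) : (touchingGraph K).CliqueFree 5 := by
  by_contra hcl
  let φ := SimpleGraph.topEmbeddingOfNotCliqueFree hcl
  have hadj : ∀ i j : Fin 5, i ≠ j → ∃ p, TouchesAt (K (φ i)) (K (φ j)) p := fun i j hij =>
    φ.map_adj_iff.2 hij
  have hne : ∀ i, (interior (K (φ i))).Nonempty := fun i => by
    obtain ⟨p, hp⟩ := hadj i (i + 1) (by fin_cases i <;> decide)
    exact hp.left_nonempty
  have hd : Pairwise fun i j => Disjoint (interior (K (φ i))) (interior (K (φ j))) :=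
    fun i j hij => (hadj i j hij).choose_spec.disjoint
  let e : EuclideanSpace ℝ (Fin 2) ≃L[ℝ] ℂ :=
    Complex.orthonormalBasisOneI.repr.symm.toContinuousLinearEquiv
  refine not_five_pairwise_contacts (O := fun i => e '' interior (K (φ i)))
    (fun i => e.toHomeomorph.isOpenMap _ isOpen_interior)
    (fun i => (hK _).interior.is_linear_image e.toLinearMap.isLinear) (fun i => (hne i).image _)
    (fun i j hij => (disjoint_image_iff e.injective).2 (hd hij)) ?_
  intro z
  induction z with | _ i j
  intro hij
  obtain ⟨p, hp⟩ := hadj i j (by simpa using hij)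
  refine ⟨e p, fun k => ?_⟩
  have himage : closure (e '' interior (K (φ k))) = e '' closure (interior (K (φ k))) :=
    (e.toHomeomorph.image_closure _).symm
  rw [himage, e.injective.mem_set_image, Sym2.mem_iff]
  exact hp.mem_closure_interior_iff (K := fun i => K (φ i)) (fun i => hK _) hne hd k

lemma ncard_edgeSet_le_turanNumber4 {n : ℕ} {G : SimpleGraph (Fin n)} (hG : G.CliqueFree 5) :
    G.edgeSet.ncard ≤ turanNumber4 n := by
  refine le_csSup (Set.Finite.bddAbove ?_) ⟨G, hG, rfl⟩
  refine (Set.finite_range fun G : SimpleGraph (Fin n) => G.edgeSet.ncard).subset ?_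
  rintro _ ⟨G, -, rfl⟩
  exact ⟨G, rfl⟩

/-- The number of `1`-ordinary flats (ordinary lines) of the complement of a union of
`n` convex sets in the plane is at most the Turán number `t(n,4)`. -/
theorem ordinary_lines_card_le_turan (n : ℕ)
    (K : Fin n → Set (EuclideanSpace ℝ (Fin 2))) (hK : ∀ i, Convex ℝ (K i)) :
    {H : AffineSubspace ℝ (EuclideanSpace ℝ (Fin 2)) |
      IsOrdinaryFlat (⋃ i, K i)ᶜ 1 H}.encard ≤ (turanNumber4 n : ℕ∞) := by
  have h : ∀ H : {H : AffineSubspace ℝ (EuclideanSpace ℝ (Fin 2)) |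
      IsOrdinaryFlat (⋃ i, K i)ᶜ 1 H}, _ :=
    fun H => exists_touchesAt_of_isOrdinaryFlat hK H.2
  choose i j p hT hp hsub hev using h
  have hle : {H : AffineSubspace ℝ (EuclideanSpace ℝ (Fin 2)) |
      IsOrdinaryFlat (⋃ i, K i)ᶜ 1 H}.encard ≤ (touchingGraph K).edgeSet.encard := by
    let edge : {H : AffineSubspace ℝ (EuclideanSpace ℝ (Fin 2)) |
        IsOrdinaryFlat (⋃ i, K i)ᶜ 1 H} → (touchingGraph K).edgeSet :=
      fun H => ⟨s(i H, j H), p H, hT H⟩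
    have hinj : Function.Injective edge := by
      intro H H' hHH
      have heq : s(i H, j H) = s(i H', j H') := congrArg Subtype.val hHH
      refine Subtype.ext (AffineSubspace.eq_of_eventually_mem (H.2.1.trans H'.2.1.symm) (hp H) ?_)
      filter_upwards [hev H] with x hx hxH
      obtain ⟨h1, h2⟩ := hx hxH
      rcases Sym2.eq_iff.1 heq with ⟨hi, hj⟩ | ⟨hi, hj⟩
      · exact hsub H' x (hi ▸ h1) (hj ▸ h2)
      · exact hsub H' x (hj ▸ h2) (hi ▸ h1)
    exact Function.Embedding.encard_le ⟨edge, hinj⟩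
  refine hle.trans ?_
  rw [← (Set.toFinite _).cast_ncard_eq]
  exact_mod_cast ncard_edgeSet_le_turanNumber4 (touchingGraph_cliqueFree hK)
end
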